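/- There exist constants c, C > 0 and x₀ ≥ 3 such that for all reals x ≥ x₀: c·x/log log x ≤ max_{k, k' ∈ ℕ} #{n ≤ x : ω(n) = k and ω(n+1) = k'} ≤ C·x/log log x. -/

import Mathlib

section P1
open Finset in
theorem mertens_one (n : ℕ) :
    ∑ p ∈ Nat.primesLE n, Real.log p / p ≤ 2 * Real.log n := by
  rcases Nat.eq_zero_or_pos n with rfl | hn
  · simp [Nat.primesLE]
  have hn' : (0 : ℝ) < n := by exact_mod_cast hn
  have h1 : ∀ k ∈ Icc 1 n, ∑ p ∈ Nat.primesLE n, (if p ∣ k then Real.log p else 0) ≤ Real.log n := by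
    intro k hk
    rw [mem_Icc] at hk
    rw [← sum_filter]
    have hsub : (Nat.primesLE n).filter (fun p => p ∣ k) ⊆ k.primeFactors := by
      intro p hp
      rw [mem_filter, Nat.mem_primesLE] at hp
      rw [Nat.mem_primeFactors]
      exact ⟨hp.1.2, hp.2, by omega⟩
    calc _ ≤ ∑ p ∈ k.primeFactors, Real.log p :=
          sum_le_sum_of_subset_of_nonneg hsub (fun p _ _ => Real.log_natCast_nonneg p)
      _ = Real.log ((∏ p ∈ k.primeFactors, p : ℕ) : ℝ) := by
          push_cast
          rw [Real.log_prod]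
          intro p hp
          exact_mod_cast (Nat.prime_of_mem_primeFactors hp).ne_zero
      _ ≤ Real.log n := by
          apply Real.log_le_log
          · exact_mod_cast Finset.prod_pos (fun p hp => (Nat.prime_of_mem_primeFactors hp).pos)
          · exact_mod_cast (Nat.le_of_dvd (by omega) (Nat.prod_primeFactors_dvd k)).trans hk.2
  have h2 : ∑ k ∈ Icc 1 n, ∑ p ∈ Nat.primesLE n, (if p ∣ k then Real.log p else 0) ≤ n * Real.log n := by
    refine (sum_le_sum h1).trans ?_
    simp
  rw [sum_comm] at h2
  have h3 : ∀ p ∈ Nat.primesLE n, (n : ℝ) / 2 * (Real.log p / p) ≤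
      ∑ k ∈ Icc 1 n, (if p ∣ k then Real.log p else 0) := by
    intro p hp
    rw [Nat.mem_primesLE] at hp
    have hp0 : 0 < p := hp.2.pos
    have hp0' : (0 : ℝ) < p := by exact_mod_cast hp0
    rw [← sum_filter, sum_const, nsmul_eq_mul]
    have hc : ((Icc 1 n).filter (fun k => p ∣ k)).card = n / p := by
      rw [← Nat.card_multiples' n p]
      congr 1
      ext k
      simp only [mem_filter, mem_Icc, mem_range]
      constructor
      · rintro ⟨⟨a, b⟩, c⟩; exact ⟨by omega, by omega, c⟩
      · rintro ⟨a, b, c⟩; exact ⟨⟨by omega, by omega⟩, c⟩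
    rw [hc]
    have hq : (n : ℝ) ≤ 2 * p * ((n / p : ℕ) : ℝ) := by
      have h4 : 1 ≤ n / p := (Nat.one_le_div_iff hp0).2 hp.1
      have h5 : n < p * (n / p) + p := by
        have := Nat.div_add_mod n p
        have := Nat.mod_lt n hp0
        omega
      have h6 : p * 1 ≤ p * (n / p) := Nat.mul_le_mul_left _ h4
      have : n ≤ 2 * p * (n / p) := by nlinarith
      exact_mod_cast this
    have hl : 0 ≤ Real.log p := Real.log_natCast_nonneg p
    rw [show (n : ℝ) / 2 * (Real.log p / p) = (n / (2 * p)) * Real.log p by field_simp]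
    apply mul_le_mul_of_nonneg_right _ hl
    rw [div_le_iff₀ (by positivity)]
    linarith
  have h4 := (sum_le_sum h3).trans h2
  rw [← mul_sum] at h4
  have : (n : ℝ) * (∑ p ∈ Nat.primesLE n, Real.log p / p) ≤ n * (2 * Real.log n) := by linarith
  exact le_of_mul_le_mul_left this hn'

noncomputable def powHom (s : ℝ) (hs : 0 < s) : ℕ →*₀ ℝ where
  toFun n := (n : ℝ) ^ (-s)
  map_zero' := by simp [Real.zero_rpow, hs.ne']
  map_one' := by simp
  map_mul' a b := by
    push_cast
    exact Real.mul_rpow (by positivity) (by positivity)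

theorem powHom_apply (s : ℝ) (hs : 0 < s) (n : ℕ) : powHom s hs n = (n : ℝ) ^ (-s) := rfl

theorem powHom_lt (s : ℝ) (hs : 0 < s) {p : ℕ} (hp : p.Prime) : ‖powHom s hs p‖ < 1 := by
  rw [powHom_apply, Real.norm_of_nonneg (by positivity)]
  exact Real.rpow_lt_one_of_one_lt_of_neg (by exact_mod_cast hp.one_lt) (by linarith)

theorem zeta_partial (ε : ℝ) (hε : 0 < ε) (n : ℕ) :
    ∑ i ∈ Finset.range (n + 2), (i : ℝ) ^ (-(1 + ε)) ≤ 1 + (1 - ((n : ℝ) + 1) ^ (-ε)) / ε := by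
  induction n with
  | zero =>
    simp [Finset.sum_range_succ]
    rw [Real.zero_rpow (by linarith)]
  | succ n ih =>
    rw [Finset.sum_range_succ]
    have hm : (0 : ℝ) < (n : ℝ) + 2 := by positivity
    have hm1 : (0 : ℝ) < (n : ℝ) + 1 := by positivity
    have key : ε * ((n : ℝ) + 2) ^ (-(1 + ε)) ≤ ((n : ℝ) + 1) ^ (-ε) - ((n : ℝ) + 2) ^ (-ε) := by
      have e1 : ((n : ℝ) + 2) ^ (-(1 + ε)) = ((n : ℝ) + 2) ^ (-ε) / ((n : ℝ) + 2) := by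
        rw [neg_add, Real.rpow_add hm, Real.rpow_neg_one, mul_comm]; rfl
      have e2 : ((n : ℝ) + 1) ^ (-ε) = ((n : ℝ) + 2) ^ (-ε) * (((n : ℝ) + 1) / (n + 2)) ^ (-ε) := by
        rw [← Real.mul_rpow (by positivity) (by positivity)]
        congr 1; field_simp
      have e3 : 1 + ε / ((n : ℝ) + 2) ≤ (((n : ℝ) + 1) / (n + 2)) ^ (-ε) := by
        rw [Real.rpow_def_of_pos (by positivity)]
        have := Real.add_one_le_exp (Real.log (((n : ℝ) + 1) / (n + 2)) * -ε)
        have h2 := Real.log_le_sub_one_of_pos (show (0 : ℝ) < ((n : ℝ) + 1) / (n + 2) by positivity)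
        have h3 : ((n : ℝ) + 1) / (n + 2) - 1 = - (1 / (n + 2)) := by field_simp; ring
        rw [h3] at h2
        have h4 : ε / ((n : ℝ) + 2) = ε * (1 / (n + 2)) := by ring
        rw [h4]
        nlinarith
      rw [e1, e2]
      have hp : 0 < ((n : ℝ) + 2) ^ (-ε) := by positivity
      have := mul_le_mul_of_nonneg_left e3 hp.le
      have h5 : ε * (((n : ℝ) + 2) ^ (-ε) / ((n : ℝ) + 2)) = ((n : ℝ) + 2) ^ (-ε) * (ε / ((n : ℝ) + 2)) := by ring
      rw [h5]; linarith
    have c1 : (((n + 1 : ℕ) : ℝ) + 1) = (n : ℝ) + 2 := by push_cast; ring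
    have c2 : (((n + 2 : ℕ) : ℝ)) = (n : ℝ) + 2 := by push_cast; ring
    rw [show n + 1 + 1 = n + 2 by rfl, c1, c2]
    have k2 : ((n : ℝ) + 2) ^ (-(1 + ε)) ≤ (((n : ℝ) + 1) ^ (-ε) - ((n : ℝ) + 2) ^ (-ε)) / ε := by
      rw [le_div_iff₀ hε]; linarith
    calc _ ≤ 1 + (1 - ((n : ℝ) + 1) ^ (-ε)) / ε + (((n : ℝ) + 1) ^ (-ε) - ((n : ℝ) + 2) ^ (-ε)) / ε :=
          add_le_add ih k2
      _ = _ := by ring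

theorem zeta_sum_le (ε : ℝ) (hε : 0 < ε) (n : ℕ) :
    ∑ i ∈ Finset.range n, (i : ℝ) ^ (-(1 + ε)) ≤ 1 + 1 / ε := by
  calc _ ≤ ∑ i ∈ Finset.range (n + 2), (i : ℝ) ^ (-(1 + ε)) := by
        apply Finset.sum_le_sum_of_subset_of_nonneg
        · intro i; simp; omega
        · intros; positivity
    _ ≤ _ := zeta_partial ε hε n
    _ ≤ _ := by
        gcongr
        have : 0 ≤ ((n : ℝ) + 1) ^ (-ε) := by positivity
        linarith

theorem euler_prod_upper (ε : ℝ) (hε : 0 < ε) (n : ℕ) :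
    ∏ p ∈ Nat.primesBelow n, (1 - (p : ℝ) ^ (-(1 + ε)))⁻¹ ≤ 1 + 1 / ε := by
  have hs : 0 < 1 + ε := by linarith
  have h := EulerProduct.summable_and_hasSum_smoothNumbers_prod_primesBelow_geometric
    (f := (powHom (1 + ε) hs).toMonoidHom) (fun hp => powHom_lt (1 + ε) hs hp) n
  have hc : ∀ n, (powHom (1 + ε) hs).toMonoidHom n = (n : ℝ) ^ (-(1 + ε)) := fun n => rfl
  simp only [hc] at h
  rw [← h.2.tsum_eq]
  have hsm : Summable (fun i : ℕ => (i : ℝ) ^ (-(1 + ε))) :=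
    summable_of_sum_range_le (fun i => by positivity) (zeta_sum_le ε hε)
  calc _ ≤ ∑' i : ℕ, (i : ℝ) ^ (-(1 + ε)) :=
        hsm.tsum_subtype_le (fun i : ℕ => (i : ℝ) ^ (-(1 + ε))) _ (fun i => by positivity)
    _ ≤ _ := Real.tsum_le_of_sum_range_le (fun i => by positivity) (zeta_sum_le ε hε)

theorem euler_prod_lower (n : ℕ) :
    Real.log (n + 1) ≤ ∏ p ∈ Nat.primesLE n, (1 - (p : ℝ)⁻¹)⁻¹ := by
  have h := EulerProduct.summable_and_hasSum_smoothNumbers_prod_primesBelow_geometric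
    (f := (powHom 1 one_pos).toMonoidHom) (fun hp => powHom_lt 1 one_pos hp) (n + 1)
  have hc : ∀ n, (powHom 1 one_pos).toMonoidHom n = (n : ℝ) ^ (-(1 : ℝ)) := fun n => rfl
  simp only [hc, Real.rpow_neg_one] at h
  rw [Nat.primesLE, ← h.2.tsum_eq]
  have h0 := log_add_one_le_harmonic n
  rw [Nat.cast_add, Nat.cast_one] at h0
  refine h0.trans ?_
  rw [harmonic_eq_sum_Icc]
  push_cast
  have hs : ∀ i ∈ Finset.Icc 1 n, i ∈ (n + 1).smoothNumbers := by
    intro i hi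
    rw [Finset.mem_Icc] at hi
    exact Nat.mem_smoothNumbers_of_lt hi.1 (by omega)
  rw [← Finset.sum_attach]
  have hinj : Function.Injective (fun i : {x // x ∈ Finset.Icc 1 n} =>
      (⟨i.1, hs i.1 i.2⟩ : (n + 1).smoothNumbers)) := by
    intro a b hab
    exact Subtype.ext (congrArg (fun z : (n + 1).smoothNumbers => (z : ℕ)) hab)
  have h3 := h.2.summable.sum_le_tsum (Finset.univ.map ⟨_, hinj⟩) (fun i _ => by positivity)
  rw [Finset.sum_map] at h3
  exact h3

theorem mertens_two_upper (n : ℕ) (hn : 2 ≤ n) :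
    ∑ p ∈ Nat.primesLE n, (p : ℝ)⁻¹ ≤ Real.log (Real.log n) + 4 := by
  have hL : 0 < Real.log n := Real.log_pos (by exact_mod_cast hn)
  set ε := 1 / Real.log n with hεd
  have hε : 0 < ε := by positivity
  have h1 := euler_prod_upper ε hε (n + 1)
  have hpr : ∀ p ∈ Nat.primesLE n, p.Prime := fun p hp => (Nat.mem_primesLE.1 hp).2
  have hlt : ∀ p ∈ Nat.primesLE n, (p : ℝ) ^ (-(1 + ε)) < 1 := fun p hp =>
    Real.rpow_lt_one_of_one_lt_of_neg (by exact_mod_cast (hpr p hp).one_lt) (by linarith)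
  have h2 : ∑ p ∈ Nat.primesLE n, (p : ℝ) ^ (-(1 + ε)) ≤ Real.log (1 + Real.log n) := by
    have : ∑ p ∈ Nat.primesLE n, (p : ℝ) ^ (-(1 + ε)) ≤
        ∑ p ∈ Nat.primesLE n, Real.log (1 - (p : ℝ) ^ (-(1 + ε)))⁻¹ := by
      apply Finset.sum_le_sum
      intro p hp
      rw [Real.log_inv]
      have := Real.log_le_sub_one_of_pos (show 0 < 1 - (p : ℝ) ^ (-(1 + ε)) by linarith [hlt p hp])
      linarith
    refine this.trans ?_
    rw [← Real.log_prod]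
    · apply Real.log_le_log
      · apply Finset.prod_pos
        intro p hp
        have := hlt p hp
        exact inv_pos.2 (by linarith)
      · have e : 1 / ε = Real.log n := by rw [hεd]; simp
        rw [e] at h1
        exact h1
    · intro p hp
      have := hlt p hp
      exact (inv_pos.2 (by linarith)).ne'
  have h3 : Real.log (1 + Real.log n) ≤ Real.log (Real.log n) + 2 := by
    have : 1 + Real.log n = Real.log n * (1 + 1 / Real.log n) := by field_simp; ring
    rw [this, Real.log_mul hL.ne' (by positivity)]
    have h4 : 1 / Real.log n ≤ 2 := by
      rw [div_le_iff₀ hL]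
      have : Real.log 2 ≤ Real.log n := Real.log_le_log (by norm_num) (by exact_mod_cast hn)
      linarith [Real.log_two_gt_d9]
    have := Real.log_le_sub_one_of_pos (show 0 < 1 + 1 / Real.log n by positivity)
    linarith
  have h4 : ∑ p ∈ Nat.primesLE n, ((p : ℝ)⁻¹ - (p : ℝ) ^ (-(1 + ε))) ≤ 2 := by
    calc _ ≤ ∑ p ∈ Nat.primesLE n, ε * (Real.log p / p) := by
          apply Finset.sum_le_sum
          intro p hp
          have hp0 : (0 : ℝ) < p := by exact_mod_cast (hpr p hp).pos
          rw [neg_add, Real.rpow_add hp0, Real.rpow_neg_one]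
          have : 1 - ε * Real.log p ≤ (p : ℝ) ^ (-ε) := by
            rw [Real.rpow_def_of_pos hp0]
            have := Real.add_one_le_exp (Real.log p * -ε)
            linarith
          have hi : 0 < (p : ℝ)⁻¹ := by positivity
          rw [div_eq_mul_inv]
          nlinarith
      _ = ε * ∑ p ∈ Nat.primesLE n, Real.log p / p := by rw [Finset.mul_sum]
      _ ≤ ε * (2 * Real.log n) := by gcongr; exact mertens_one n
      _ = 2 := by rw [hεd]; field_simp
  rw [Finset.sum_sub_distrib] at h4
  linarith

theorem sum_inv_sq (s : Finset ℕ) : ∑ p ∈ s, ((p : ℝ) ^ 2)⁻¹ ≤ 2 := by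
  obtain ⟨n, hn⟩ := s.exists_nat_subset_range
  have : ∑ p ∈ s, ((p : ℝ) ^ 2)⁻¹ ≤ ∑ i ∈ Finset.range n, (i : ℝ) ^ (-(1 + (1 : ℝ))) := by
    have e : ∀ i : ℕ, (i : ℝ) ^ (-(1 + (1 : ℝ))) = ((i : ℝ) ^ 2)⁻¹ := by
      intro i
      rw [Real.rpow_neg (by positivity)]
      norm_num
    simp only [e]
    exact Finset.sum_le_sum_of_subset_of_nonneg hn (fun i _ _ => by positivity)
  have h2 := zeta_sum_le 1 one_pos n
  linarith

theorem mertens_two_lower (n : ℕ) (hn : 2 ≤ n) :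
    Real.log (Real.log n) - 4 ≤ ∑ p ∈ Nat.primesLE n, (p : ℝ)⁻¹ := by
  have hL : 0 < Real.log n := Real.log_pos (by exact_mod_cast hn)
  have hpr : ∀ p ∈ Nat.primesLE n, p.Prime := fun p hp => (Nat.mem_primesLE.1 hp).2
  have h1 : Real.log n ≤ ∏ p ∈ Nat.primesLE n, (1 - (p : ℝ)⁻¹)⁻¹ :=
    (Real.log_le_log (by positivity) (by linarith)).trans (euler_prod_lower n)
  have hp2 : ∀ p ∈ Nat.primesLE n, (2 : ℝ) ≤ p := fun p hp => by exact_mod_cast (hpr p hp).two_le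
  have hlt : ∀ p ∈ Nat.primesLE n, 0 < 1 - (p : ℝ)⁻¹ := fun p hp => by
    have := hp2 p hp
    have : (p : ℝ)⁻¹ ≤ 2⁻¹ := inv_anti₀ (by norm_num) this
    norm_num at this ⊢; linarith
  have h2 := Real.log_le_log hL h1
  rw [Real.log_prod (fun p hp => (inv_pos.2 (hlt p hp)).ne')] at h2
  have h3 : ∑ p ∈ Nat.primesLE n, Real.log (1 - (p : ℝ)⁻¹)⁻¹ ≤
      ∑ p ∈ Nat.primesLE n, ((p : ℝ)⁻¹ + 2 * ((p : ℝ) ^ 2)⁻¹) := by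
    apply Finset.sum_le_sum
    intro p hp
    have h0 := hlt p hp
    have h02 := hp2 p hp
    refine (Real.log_le_sub_one_of_pos (inv_pos.2 h0)).trans ?_
    have : (1 - (p : ℝ)⁻¹)⁻¹ - 1 = 1 / (p - 1) := by
      have : (p : ℝ) - 1 ≠ 0 := by linarith
      have : (p : ℝ) ≠ 0 := by linarith
      field_simp
      ring
    rw [this]
    have e : (p : ℝ)⁻¹ + 2 * ((p : ℝ) ^ 2)⁻¹ = (p + 2) / p ^ 2 := by
      have : (p : ℝ) ≠ 0 := by linarith
      field_simp
    rw [e, div_le_div_iff₀ (by linarith) (by positivity)]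
    nlinarith
  rw [Finset.sum_add_distrib, ← Finset.mul_sum] at h3
  have := sum_inv_sq (Nat.primesLE n)
  linarith

end P1

section P2
open Finset BoundingSieve
open scoped ArithmeticFunction.Moebius

theorem sum_moebius_multiples {m l : ℕ} (hm : Squarefree m) (hl : l ∣ m) :
    ∑ d ∈ m.divisors.filter (fun d => l ∣ d), (μ d : ℝ) = if m = l then (μ l : ℝ) else 0 := by
  obtain ⟨k, rfl⟩ := hl
  have hl0 : l ≠ 0 := by rintro rfl; simp at hm
  have hk0 : k ≠ 0 := by rintro rfl; simp at hm
  have hset : (l * k).divisors.filter (fun d => l ∣ d) = k.divisors.image (fun e => l * e) := by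
    ext d
    simp only [mem_filter, Nat.mem_divisors, mem_image]
    constructor
    · rintro ⟨⟨h1, h2⟩, ⟨e, rfl⟩⟩
      exact ⟨e, ⟨(Nat.mul_dvd_mul_iff_left (Nat.pos_of_ne_zero hl0)).1 h1, hk0⟩, rfl⟩
    · rintro ⟨e, ⟨h1, h2⟩, rfl⟩
      exact ⟨⟨Nat.mul_dvd_mul_left _ h1, by positivity⟩, dvd_mul_right _ _⟩
  rw [hset, sum_image (fun a _ b _ h => Nat.eq_of_mul_eq_mul_left (Nat.pos_of_ne_zero hl0) h)]
  have hco : l.Coprime k := Nat.coprime_of_squarefree_mul hm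
  have h1 : ∀ e ∈ k.divisors, (μ (l * e) : ℝ) = μ l * μ e := by
    intro e he
    rw [ArithmeticFunction.isMultiplicative_moebius.map_mul_of_coprime
      (hco.coprime_dvd_right (Nat.dvd_of_mem_divisors he))]
    push_cast; rfl
  rw [sum_congr rfl h1, ← mul_sum]
  have h2 : ∑ e ∈ k.divisors, (μ e : ℝ) = if k = 1 then 1 else 0 := by
    have h := congrArg (fun f : ArithmeticFunction ℝ => f k)
      (ArithmeticFunction.coe_moebius_mul_coe_zeta (R := ℝ))
    simp only [ArithmeticFunction.coe_mul_zeta_apply, ArithmeticFunction.one_apply] at h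
    simpa using h
  rw [h2]
  have : l * k = l ↔ k = 1 := by
    constructor
    · intro h; exact Nat.eq_of_mul_eq_mul_left (Nat.pos_of_ne_zero hl0) (by simpa using h)
    · rintro rfl; simp
  simp [this]

noncomputable def selS (s : BoundingSieve) (R : ℝ) : ℝ :=
  ∑ l ∈ s.prodPrimes.divisors.filter (fun l : ℕ => (l : ℝ) ≤ R), s.selbergTerms l

theorem selS_pos (s : BoundingSieve) (R : ℝ) (hR : 1 ≤ R) : 0 < selS s R := by
  unfold selS
  apply sum_pos
  · intro l hl
    exact selbergTerms_pos (Nat.dvd_of_mem_divisors (mem_filter.1 hl).1)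
  · exact ⟨1, by simp [prodPrimes_ne_zero, hR]⟩

noncomputable def selw (s : BoundingSieve) (R : ℝ) (d : ℕ) : ℝ :=
  if d ∣ s.prodPrimes then
    (s.nu d)⁻¹ * (μ d * ((selS s R)⁻¹ *
      ∑ l ∈ (s.prodPrimes.divisors.filter (fun l : ℕ => (l : ℝ) ≤ R)).filter (fun l => d ∣ l),
        s.selbergTerms l)) else 0

theorem selw_one (s : BoundingSieve) (R : ℝ) (hR : 1 ≤ R) : selw s R 1 = 1 := by
  have h := (selS_pos s R hR).ne'
  have h1 : s.nu 1 = 1 := s.nu_mult.map_one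
  simp only [selw, one_dvd, if_true, h1, filter_true]
  have e : ∑ l ∈ s.prodPrimes.divisors.filter (fun l : ℕ => (l : ℝ) ≤ R), s.selbergTerms l
    = selS s R := rfl
  rw [e]
  simp [h]

theorem selw_zero (s : BoundingSieve) (R : ℝ) (d : ℕ) (hd : R < d) : selw s R d = 0 := by
  unfold selw
  split_ifs with h
  · rw [filter_eq_empty_iff.2]
    · simp
    · intro l hl hdl
      rw [mem_filter, Nat.mem_divisors] at hl
      have : d ≤ l := Nat.le_of_dvd (Nat.pos_of_dvd_of_pos hl.1.1 (Nat.pos_of_ne_zero hl.1.2)) hdl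
      have : (d : ℝ) ≤ l := by exact_mod_cast this
      linarith [hl.2]
  · rfl

theorem selw_abs (s : BoundingSieve) (R : ℝ) (hR : 1 ≤ R) (d : ℕ) (hd : d ∣ s.prodPrimes) :
    |selw s R d| ≤ (s.nu d)⁻¹ := by
  have hS := selS_pos s R hR
  have hn := nu_pos_of_dvd_prodPrimes hd
  have hg : ∀ l ∈ s.prodPrimes.divisors.filter (fun l : ℕ => (l : ℝ) ≤ R), 0 ≤ s.selbergTerms l :=
    fun l hl => (selbergTerms_pos (Nat.dvd_of_mem_divisors (mem_filter.1 hl).1)).le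
  unfold selw
  rw [if_pos hd, abs_mul, abs_of_pos (inv_pos.2 hn)]
  apply mul_le_of_le_one_right (inv_pos.2 hn).le
  have hmu : |(μ d : ℝ)| ≤ 1 := by exact_mod_cast ArithmeticFunction.abs_moebius_le_one
  rw [abs_mul]
  apply mul_le_one₀ hmu (abs_nonneg _)
  rw [abs_of_nonneg]
  · rw [inv_mul_le_iff₀ hS, mul_one]
    exact sum_le_sum_of_subset_of_nonneg (filter_subset _ _) (fun l hl _ => hg l hl)
  · exact mul_nonneg (inv_pos.2 hS).le (sum_nonneg fun l hl => hg l (mem_filter.1 hl).1)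

theorem selw_main (s : BoundingSieve) (R : ℝ) (hR : 1 ≤ R) :
    s.mainSum (lambdaSquared (selw s R)) = (selS s R)⁻¹ := by
  have hS := selS_pos s R hR
  rw [mainSum_lambdaSquared_eq_sum_mul_sum_sq]
  have key : ∀ l ∈ s.prodPrimes.divisors,
      (∑ d ∈ s.prodPrimes.divisors, if l ∣ d then s.nu d * selw s R d else 0) =
      if (l : ℝ) ≤ R then (selS s R)⁻¹ * (s.selbergTerms l * μ l) else 0 := by
    intro l hl
    calc _ = ∑ d ∈ s.prodPrimes.divisors, ∑ m ∈ s.prodPrimes.divisors.filter (fun l : ℕ => (l : ℝ) ≤ R),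
          if l ∣ d ∧ d ∣ m then (selS s R)⁻¹ * s.selbergTerms m * μ d else 0 := by
          apply sum_congr rfl
          intro d hd
          have hdP := Nat.dvd_of_mem_divisors hd
          have hn := nu_pos_of_dvd_prodPrimes hdP
          by_cases h : l ∣ d
          · simp only [h, true_and, if_true]
            rw [← sum_filter, selw, if_pos hdP, ← mul_assoc, mul_inv_cancel₀ hn.ne', one_mul,
              mul_sum, mul_sum]
            apply sum_congr rfl
            intro m hm
            ring
          · simp [h]
      _ = ∑ m ∈ s.prodPrimes.divisors.filter (fun l : ℕ => (l : ℝ) ≤ R),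
          if m = l then (selS s R)⁻¹ * s.selbergTerms m * μ l else 0 := by
          rw [sum_comm]
          apply sum_congr rfl
          intro m hm
          have hmP := (Nat.dvd_of_mem_divisors (mem_filter.1 hm).1)
          have hmsq := squarefree_of_dvd_prodPrimes hmP
          rw [← sum_filter, ← mul_sum]
          have hset : s.prodPrimes.divisors.filter (fun d => l ∣ d ∧ d ∣ m) =
              m.divisors.filter (fun d => l ∣ d) := by
            ext d
            simp only [mem_filter, Nat.mem_divisors]
            constructor
            · rintro ⟨⟨a, b⟩, c, e⟩; exact ⟨⟨e, hmsq.ne_zero⟩, c⟩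
            · rintro ⟨⟨a, b⟩, c⟩; exact ⟨⟨a.trans hmP, prodPrimes_ne_zero⟩, c, a⟩
          rw [hset]
          by_cases hlm : l ∣ m
          · rw [sum_moebius_multiples hmsq hlm]
            split_ifs <;> simp
          · rw [filter_eq_empty_iff.2]
            · rw [if_neg]
              · simp
              · rintro rfl; exact hlm dvd_rfl
            · intro d hd hld
              exact hlm (hld.trans (Nat.dvd_of_mem_divisors hd))
      _ = _ := by
          rw [sum_ite_eq']
          simp only [mem_filter, hl, true_and]
          split_ifs
          · ring
          · rfl
  calc _ = ∑ l ∈ s.prodPrimes.divisors, if (l : ℝ) ≤ R then (selS s R)⁻¹ ^ 2 * s.selbergTerms l else 0 := by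
        apply sum_congr rfl
        intro l hl
        rw [key l hl]
        have hlP := Nat.dvd_of_mem_divisors hl
        have hg := (selbergTerms_pos hlP).ne'
        have hmu : (μ l : ℝ) ^ 2 = 1 := by
          have := ArithmeticFunction.moebius_sq_eq_one_of_squarefree (squarefree_of_dvd_prodPrimes hlP)
          exact_mod_cast this
        split_ifs
        · rw [mul_pow, mul_pow, hmu]
          field_simp
        · simp
    _ = (selS s R)⁻¹ := by
        rw [← sum_filter, ← mul_sum, ← selS, sq, mul_assoc, inv_mul_cancel₀ hS.ne', mul_one]

theorem selberg_err (s : BoundingSieve) (R : ℝ) (hR : 1 ≤ R)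
    (hnu : ∀ d, d ∣ s.prodPrimes → (s.nu d)⁻¹ ≤ d)
    (hrem : ∀ d, d ∣ s.prodPrimes → |s.rem d| ≤ d) :
    s.errSum (lambdaSquared (selw s R)) ≤ R ^ 6 := by
  set D := s.prodPrimes.divisors.filter (fun l : ℕ => (l : ℝ) ≤ R) with hD
  have hw0 : ∀ d, d ∣ s.prodPrimes → d ∉ D → selw s R d = 0 := by
    intro d hd hdD
    apply selw_zero
    by_contra h
    push Not at h
    exact hdD (by rw [hD, mem_filter, Nat.mem_divisors]; exact ⟨⟨hd, prodPrimes_ne_zero⟩, h⟩)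
  have hwR : ∀ d ∈ D, |selw s R d| ≤ R := by
    intro d hd
    rw [hD, mem_filter, Nat.mem_divisors] at hd
    exact ((selw_abs s R hR d hd.1.1).trans (hnu d hd.1.1)).trans hd.2
  have hcard : (D.card : ℝ) ≤ R := by
    have h1 : D ⊆ Icc 1 ⌊R⌋₊ := by
      intro d hd
      rw [hD, mem_filter, Nat.mem_divisors] at hd
      rw [mem_Icc]
      exact ⟨Nat.pos_of_dvd_of_pos hd.1.1 (Nat.pos_of_ne_zero hd.1.2), Nat.le_floor hd.2⟩
    have h2 := card_le_card h1
    rw [Nat.card_Icc] at h2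
    calc (D.card : ℝ) ≤ (⌊R⌋₊ : ℝ) := by exact_mod_cast (by omega : D.card ≤ ⌊R⌋₊)
      _ ≤ R := Nat.floor_le (by linarith)
  have h1 : ∀ d ∈ s.prodPrimes.divisors, |lambdaSquared (selw s R) d| * |s.rem d| ≤
      ∑ d1 ∈ D, ∑ d2 ∈ D, if d = Nat.lcm d1 d2 then R ^ 4 else 0 := by
    intro d hd
    have hdP := Nat.dvd_of_mem_divisors hd
    have e1 : lambdaSquared (selw s R) d =
        ∑ d1 ∈ d.divisors.filter (fun x => x ∈ D), ∑ d2 ∈ d.divisors.filter (fun x => x ∈ D),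
          if d = Nat.lcm d1 d2 then selw s R d1 * selw s R d2 else 0 := by
      unfold lambdaSquared
      rw [sum_filter]
      apply sum_congr rfl
      intro d1 hd1
      have hd1P := (Nat.dvd_of_mem_divisors hd1).trans hdP
      split_ifs with h
      · rw [sum_filter]
        apply sum_congr rfl
        intro d2 hd2
        have hd2P := (Nat.dvd_of_mem_divisors hd2).trans hdP
        split_ifs with h2 h3
        · rfl
        · rw [hw0 d2 hd2P h3, mul_zero]
        · rfl
        · rfl
      · apply sum_eq_zero
        intro d2 _
        rw [hw0 d1 hd1P h]; simp
    rw [e1]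
    have hsub : d.divisors.filter (fun x => x ∈ D) ⊆ D := fun x hx => (mem_filter.1 hx).2
    calc _ ≤ (∑ d1 ∈ d.divisors.filter (fun x => x ∈ D), ∑ d2 ∈ d.divisors.filter (fun x => x ∈ D),
          if d = Nat.lcm d1 d2 then |selw s R d1| * |selw s R d2| else 0) * |s.rem d| := by
          gcongr
          refine (abs_sum_le_sum_abs _ _).trans ?_
          gcongr with d1 _
          refine (abs_sum_le_sum_abs _ _).trans ?_
          gcongr with d2 _
          split_ifs
          · rw [abs_mul]
          · simp
      _ = ∑ d1 ∈ d.divisors.filter (fun x => x ∈ D), ∑ d2 ∈ d.divisors.filter (fun x => x ∈ D),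
          if d = Nat.lcm d1 d2 then |selw s R d1| * |selw s R d2| * |s.rem d| else 0 := by
          rw [sum_mul]
          apply sum_congr rfl
          intro d1 _
          rw [sum_mul]
          apply sum_congr rfl
          intro d2 _
          split_ifs <;> simp
      _ ≤ ∑ d1 ∈ d.divisors.filter (fun x => x ∈ D), ∑ d2 ∈ d.divisors.filter (fun x => x ∈ D),
          if d = Nat.lcm d1 d2 then R ^ 4 else 0 := by
          gcongr with d1 hd1 d2 hd2
          split_ifs with h
          · have a1 := hwR d1 (hsub hd1)
            have a2 := hwR d2 (hsub hd2)
            have b1 := (mem_filter.1 (hsub hd1)).2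
            have b2 := (mem_filter.1 (hsub hd2)).2
            have a3 : |s.rem d| ≤ R * R := by
              refine (hrem d hdP).trans ?_
              have : d ≤ d1 * d2 := by
                rw [h]
                apply Nat.le_of_dvd
                · have := Nat.pos_of_mem_divisors (mem_filter.1 hd1).1
                  have := Nat.pos_of_mem_divisors (mem_filter.1 hd2).1
                  positivity
                · exact Nat.lcm_dvd_mul d1 d2
              have : (d : ℝ) ≤ d1 * d2 := by exact_mod_cast this
              refine this.trans ?_
              gcongr
            calc _ ≤ R * R * (R * R) := by gcongr
              _ = R ^ 4 := by ring
          · rfl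
      _ ≤ ∑ d1 ∈ d.divisors.filter (fun x => x ∈ D), ∑ d2 ∈ D,
          if d = Nat.lcm d1 d2 then R ^ 4 else 0 := by
          gcongr with d1 hd1
      _ ≤ _ := by
          apply sum_le_sum_of_subset_of_nonneg hsub
          intros; apply sum_nonneg; intros; split_ifs <;> positivity
  unfold errSum
  calc _ ≤ ∑ d ∈ s.prodPrimes.divisors, ∑ d1 ∈ D, ∑ d2 ∈ D, if d = Nat.lcm d1 d2 then R ^ 4 else 0 :=
        sum_le_sum h1
    _ = ∑ d1 ∈ D, ∑ d2 ∈ D, ∑ d ∈ s.prodPrimes.divisors, if d = Nat.lcm d1 d2 then R ^ 4 else 0 := by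
        rw [sum_comm]
        apply sum_congr rfl
        intro d1 _
        rw [sum_comm]
    _ ≤ ∑ d1 ∈ D, ∑ d2 ∈ D, R ^ 4 := by
        gcongr with d1 _ d2 _
        rw [sum_ite_eq']
        split_ifs
        · rfl
        · positivity
    _ = D.card * D.card * R ^ 4 := by simp; ring
    _ ≤ R * R * R ^ 4 := by gcongr
    _ = R ^ 6 := by ring

theorem selberg_bound (s : BoundingSieve) (R : ℝ) (hR : 1 ≤ R)
    (hnu : ∀ d, d ∣ s.prodPrimes → (s.nu d)⁻¹ ≤ d)
    (hrem : ∀ d, d ∣ s.prodPrimes → |s.rem d| ≤ d) :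
    s.siftedSum ≤ s.totalMass * (selS s R)⁻¹ + R ^ 6 := by
  have h := siftedSum_le_mainSum_errSum_of_upperMoebius (s := s) (lambdaSquared (selw s R))
    (upperMoebius_lambdaSquared _ (selw_one s R hR))
  rw [selw_main s R hR] at h
  linarith [selberg_err s R hR hnu hrem]

end P2

section P3
open Finset BoundingSieve

theorem crt_count (A B M : ℕ) (hA : 0 < A) (hB : 0 < B) (h : A.Coprime B) :
    |(((Ioc 0 M).filter (fun n => A ∣ n ∧ B ∣ n + 1)).card : ℝ) - (M : ℝ) / (A * B)| ≤ 1 := by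
  obtain ⟨v, hv1, hv2⟩ := Nat.chineseRemainder h 0 (B - 1)
  have hiff : ∀ n, (A ∣ n ∧ B ∣ n + 1) ↔ n ≡ v [MOD (A * B)] := by
    intro n
    rw [← Nat.modEq_and_modEq_iff_modEq_mul h]
    have h1 : A ∣ n ↔ n ≡ v [MOD A] := by
      rw [← Nat.modEq_zero_iff_dvd]
      exact ⟨fun h => h.trans hv1.symm, fun h => h.trans hv1⟩
    have h2 : B ∣ n + 1 ↔ n ≡ v [MOD B] := by
      have e : B - 1 + 1 = B := by omega
      rw [← Nat.modEq_zero_iff_dvd]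
      constructor
      · intro h
        refine Nat.ModEq.trans ?_ hv2.symm
        apply Nat.ModEq.add_right_cancel' 1
        rw [e]
        exact h.trans (by simp [Nat.ModEq])
      · intro h
        have := (h.trans hv2).add_right 1
        rw [e] at this
        exact this.trans (by simp [Nat.ModEq])
    rw [h1, h2]
  simp only [hiff]
  have hr : 0 < A * B := by positivity
  have hc := Nat.Ioc_filter_modEq_card 0 M hr v
  set N := ((Ioc 0 M).filter (fun n => n ≡ v [MOD (A * B)])).card
  have hrq : (0 : ℚ) < ((A * B : ℕ) : ℚ) := by exact_mod_cast hr
  have hmono : ⌊(((0 : ℕ) : ℚ) - v) / ((A * B : ℕ) : ℚ)⌋ ≤ ⌊((M : ℚ) - v) / ((A * B : ℕ) : ℚ)⌋ := by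
    apply Int.floor_le_floor
    gcongr
    simp
  rw [max_eq_left (by linarith)] at hc
  have f1 := Int.floor_le ((((0 : ℕ) : ℚ) - v) / ((A * B : ℕ) : ℚ))
  have f2 := Int.lt_floor_add_one ((((0 : ℕ) : ℚ) - v) / ((A * B : ℕ) : ℚ))
  have f3 := Int.floor_le (((M : ℚ) - v) / ((A * B : ℕ) : ℚ))
  have f4 := Int.lt_floor_add_one (((M : ℚ) - v) / ((A * B : ℕ) : ℚ))
  have hc' : (N : ℚ) = (⌊((M : ℚ) - v) / ((A * B : ℕ) : ℚ)⌋ : ℚ) - ⌊(((0 : ℕ) : ℚ) - v) / ((A * B : ℕ) : ℚ)⌋ := by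
    exact_mod_cast hc
  have e : ((M : ℚ) - v) / ((A * B : ℕ) : ℚ) - (((0 : ℕ) : ℚ) - v) / ((A * B : ℕ) : ℚ) = (M : ℚ) / (A * B) := by
    push_cast; ring
  have hq : |(N : ℚ) - (M : ℚ) / (A * B)| ≤ 1 := by
    rw [abs_le]
    constructor <;> linarith
  have hr' := (Rat.cast_le (K := ℝ)).2 hq
  push_cast at hr'
  exact hr'

theorem count_dvd (a b M d : ℕ) (ha : 0 < a) (hb : 0 < b) (hab : a.Coprime b)
    (hd : Squarefree d) (hda : d.Coprime (a * b)) :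
    |(((Ioc 0 M).filter (fun n => (a ∣ n ∧ b ∣ n + 1) ∧ d ∣ n * (n + 1))).card : ℝ) -
      (d.divisors.card : ℝ) / d * ((M : ℝ) / (a * b))| ≤ d.divisors.card := by
  have hd0 : d ≠ 0 := hd.ne_zero
  have hcard := card_eq_sum_card_fiberwise (f := fun n => d.gcd n)
    (s := (Ioc 0 M).filter (fun n => (a ∣ n ∧ b ∣ n + 1) ∧ d ∣ n * (n + 1))) (t := d.divisors)
    (fun n _ => by simp [Nat.gcd_dvd_left, hd0])
  have hfib : ∀ e ∈ d.divisors,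
      (((Ioc 0 M).filter (fun n => (a ∣ n ∧ b ∣ n + 1) ∧ d ∣ n * (n + 1))).filter
        (fun n => d.gcd n = e)) =
      (Ioc 0 M).filter (fun n => (a * e) ∣ n ∧ (b * (d / e)) ∣ n + 1) := by
    intro e he
    obtain ⟨f, rfl⟩ := Nat.dvd_of_mem_divisors he
    have he0 : 0 < e := Nat.pos_of_mem_divisors he
    rw [Nat.mul_div_cancel_left _ he0]
    rw [filter_filter]
    apply filter_congr
    intro n hn
    have hae : a.Coprime e := ((hda.coprime_dvd_left (dvd_mul_right e f)).coprime_dvd_right (dvd_mul_right a b)).symm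
    have hbf : b.Coprime f := ((hda.coprime_dvd_left (dvd_mul_left f e)).coprime_dvd_right (dvd_mul_left b a)).symm
    constructor
    · rintro ⟨⟨⟨h1, h2⟩, h3⟩, h4⟩
      have hen : e ∣ n := by rw [← h4]; exact Nat.gcd_dvd_right _ _
      refine ⟨hae.mul_dvd_of_dvd_of_dvd h1 hen, hbf.mul_dvd_of_dvd_of_dvd h2 ?_⟩
      obtain ⟨k, rfl⟩ := hen
      rw [Nat.gcd_mul_left] at h4
      have h5 : f.gcd k = 1 := Nat.eq_of_mul_eq_mul_left he0 (by simpa using h4)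
      rw [mul_assoc] at h3
      have h6 := (Nat.mul_dvd_mul_iff_left he0).1 h3
      exact Nat.Coprime.dvd_of_dvd_mul_left h5 h6
    · rintro ⟨h1, h2⟩
      have hen : e ∣ n := (dvd_mul_left e a).trans h1
      have hfn : f ∣ n + 1 := (dvd_mul_left f b).trans h2
      refine ⟨⟨⟨(dvd_mul_right a e).trans h1, (dvd_mul_right b f).trans h2⟩, mul_dvd_mul hen hfn⟩, ?_⟩
      have hfc : f.Coprime n := by
        have : (n + 1).Coprime n := by simp
        exact this.coprime_dvd_left hfn
      rw [Nat.Coprime.gcd_mul_right_cancel e hfc]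
      exact Nat.gcd_eq_left hen
  rw [hcard, sum_congr rfl (fun e he => by rw [hfib e he])]
  push_cast
  have : (d.divisors.card : ℝ) / d * ((M : ℝ) / (a * b)) = ∑ e ∈ d.divisors, (M : ℝ) / ((a * b) * d) := by
    rw [sum_const, nsmul_eq_mul]
    field_simp
  rw [this, ← sum_sub_distrib]
  refine (abs_sum_le_sum_abs _ _).trans ?_
  have : (d.divisors.card : ℝ) = ∑ e ∈ d.divisors, (1 : ℝ) := by simp
  rw [this]
  apply sum_le_sum
  intro e he
  obtain ⟨f, hf⟩ := Nat.dvd_of_mem_divisors he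
  have he0 : 0 < e := Nat.pos_of_mem_divisors he
  have hdf : d / e = f := by rw [hf, Nat.mul_div_cancel_left _ he0]
  rw [hdf]
  have hf0 : 0 < f := by
    rcases Nat.eq_zero_or_pos f with h | h
    · rw [h] at hf; simp at hf; exact absurd hf hd0
    · exact h
  have hco : (a * e).Coprime (b * f) := by
    have h1 : e.Coprime (a * b) := hda.coprime_dvd_left ⟨f, hf⟩
    have h2 : f.Coprime (a * b) := hda.coprime_dvd_left ⟨e, by rw [hf, mul_comm]⟩
    have h3 : e.Coprime f := Nat.coprime_of_squarefree_mul (hf ▸ hd)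
    rw [Nat.coprime_mul_iff_left, Nat.coprime_mul_iff_right, Nat.coprime_mul_iff_right]
    exact ⟨⟨hab, (h2.coprime_dvd_right (dvd_mul_right a b)).symm⟩, h1.coprime_dvd_right (dvd_mul_left b a), h3⟩
  have := crt_count (a * e) (b * f) M (by positivity) (by positivity) hco
  have e2 : (M : ℝ) / ((a * b) * d) = M / (((a * e : ℕ) : ℝ) * ((b * f : ℕ) : ℝ)) := by
    rw [hf]; push_cast; congr 1; ring
  rw [e2]
  exact this

/-- density function -/
noncomputable def nuA : ArithmeticFunction ℝ := ⟨fun d => (d.divisors.card : ℝ) / d, by simp⟩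

theorem nuA_apply (d : ℕ) : nuA d = (d.divisors.card : ℝ) / d := rfl

theorem nuA_mult : nuA.IsMultiplicative := by
  constructor
  · simp [nuA_apply]
  · intro m n h
    rw [nuA_apply, nuA_apply, nuA_apply, h.card_divisors_mul]
    push_cast
    rw [mul_div_mul_comm]

theorem nuA_prime {p : ℕ} (hp : p.Prime) : nuA p = 2 / p := by
  rw [nuA_apply, hp.divisors, card_pair hp.one_lt.ne]; norm_num

/-- the sieve -/
noncomputable def mySieve (a b M : ℕ) (P : Finset ℕ) (hP : ∀ p ∈ P, p.Prime ∧ 2 < p) :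
    BoundingSieve where
  support := ((Ioc 0 M).filter (fun n => a ∣ n ∧ b ∣ n + 1)).image (fun n => n * (n + 1))
  prodPrimes := ∏ p ∈ P, p
  prodPrimes_squarefree := by
    apply Finset.squarefree_prod_of_pairwise_isCoprime
    · intro p hp q hq hpq
      exact Nat.coprime_iff_isRelPrime.1 ((Nat.coprime_primes (hP p hp).1 (hP q hq).1).2 hpq)
    · intro p hp
      exact (hP p hp).1.prime.squarefree
  weights := fun _ => 1
  weights_nonneg := fun _ => zero_le_one
  totalMass := (M : ℝ) / (a * b)
  nu := nuA
  nu_mult := nuA_mult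
  nu_pos_of_prime := by
    intro p hp _
    rw [nuA_prime hp]
    have := hp.pos
    positivity
  nu_lt_one_of_prime := by
    intro p hp hd
    obtain ⟨q, hq, hpq⟩ := (hp.prime.dvd_finsetProd_iff _).1 hd
    have : p = q := (Nat.prime_dvd_prime_iff_eq hp (hP q hq).1).1 hpq
    subst this
    rw [nuA_prime hp]
    have := (hP p hq).2
    have h2 : (2 : ℝ) < p := by exact_mod_cast this
    rw [div_lt_one (by linarith)]
    exact h2

theorem mySieve_bound (a b M : ℕ) (ha : 0 < a) (hb : 0 < b) (hab : a.Coprime b) (P : Finset ℕ)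
    (hP : ∀ p ∈ P, p.Prime ∧ 2 < p) (hPab : ∀ p ∈ P, ¬ p ∣ a * b) (R : ℝ) (hR : 1 ≤ R) :
    (((Ioc 0 M).filter (fun n => (a ∣ n ∧ b ∣ n + 1) ∧ ∀ p ∈ P, ¬ p ∣ n * (n + 1))).card : ℝ) ≤
      (M : ℝ) / (a * b) * (selS (mySieve a b M P hP) R)⁻¹ + R ^ 6 := by
  set s := mySieve a b M P hP with hs
  have hinj : Set.InjOn (fun n : ℕ => n * (n + 1)) (((Ioc 0 M).filter (fun n => a ∣ n ∧ b ∣ n + 1) : Finset ℕ) : Set ℕ) := by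
    intro x _ y _ hxy
    simp only at hxy
    nlinarith [hxy, lt_trichotomy x y]
  have hPd : s.prodPrimes = ∏ p ∈ P, p := rfl
  have hcop : s.prodPrimes.Coprime (a * b) := by
    rw [hPd]
    apply Nat.Coprime.prod_left
    intro p hp
    exact ((hP p hp).1.coprime_iff_not_dvd).2 (hPab p hp)
  have hb1 := selberg_bound s R hR (by
      intro d hd
      have hd0 : 0 < d := Nat.pos_of_dvd_of_pos hd (Nat.pos_of_ne_zero prodPrimes_ne_zero)
      change (nuA d)⁻¹ ≤ d
      rw [nuA_apply, inv_div]
      apply div_le_self (by positivity)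
      have : 0 < d.divisors.card := card_pos.2 ⟨1, by simp; omega⟩
      exact_mod_cast this)
    (by
      intro d hd
      have hsq := squarefree_of_dvd_prodPrimes hd
      have h1 := count_dvd a b M d ha hb hab hsq (hcop.coprime_dvd_left hd)
      have h2 : s.multSum d = (((Ioc 0 M).filter (fun n => (a ∣ n ∧ b ∣ n + 1) ∧ d ∣ n * (n + 1))).card : ℝ) := by
        change ∑ n ∈ ((Ioc 0 M).filter (fun n => a ∣ n ∧ b ∣ n + 1)).image (fun n => n * (n + 1)),
          (if d ∣ n then (1 : ℝ) else 0) = _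
        rw [sum_image hinj, ← sum_filter, filter_filter]
        simp
      have h3 : s.rem d = s.multSum d - (d.divisors.card : ℝ) / d * ((M : ℝ) / (a * b)) := rfl
      rw [h3, h2]
      refine h1.trans ?_
      exact_mod_cast Nat.card_divisors_le_self d)
  have hsift : s.siftedSum = (((Ioc 0 M).filter (fun n => (a ∣ n ∧ b ∣ n + 1) ∧ ∀ p ∈ P, ¬ p ∣ n * (n + 1))).card : ℝ) := by
    change ∑ n ∈ ((Ioc 0 M).filter (fun n => a ∣ n ∧ b ∣ n + 1)).image (fun n => n * (n + 1)),
          (if Nat.Coprime (∏ p ∈ P, p) n then (1 : ℝ) else 0) = _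
    rw [sum_image hinj, ← sum_filter, filter_filter]
    simp only [sum_const, nsmul_eq_mul, mul_one]
    congr 2
    apply filter_congr
    intro n _
    rw [Nat.coprime_prod_left_iff]
    constructor
    · rintro ⟨h1, h2⟩
      exact ⟨h1, fun p hp => ((hP p hp).1.coprime_iff_not_dvd).1 (h2 p hp)⟩
    · rintro ⟨h1, h2⟩
      exact ⟨h1, fun p hp => ((hP p hp).1.coprime_iff_not_dvd).2 (h2 p hp)⟩
  rw [hsift] at hb1
  exact hb1

end P3

section P4
open Finset BoundingSieve

theorem exp_sub_one_le_two_mul {t : ℝ} (h0 : 0 ≤ t) (h1 : t ≤ 1) : Real.exp t - 1 ≤ 2 * t := by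
  have := Real.abs_exp_sub_one_sub_id_le (x := t) (by rw [abs_of_nonneg h0]; exact h1)
  have := (abs_le.1 this).2
  nlinarith

theorem prod_rankin (f g : ℕ → ℝ) (P : Finset ℕ) 
    (hf0 : ∀ p ∈ P, 0 ≤ f p) (e : ℕ → ℝ)
    (hfg : ∀ p ∈ P, f p ≤ g p * Real.exp (e p)) :
    ∏ p ∈ P, f p ≤ (∏ p ∈ P, g p) * Real.exp (∑ p ∈ P, e p) := by
  rw [Real.exp_sum, ← prod_mul_distrib]
  exact prod_le_prod hf0 hfg

theorem rankin_sel (s : BoundingSieve) (z : ℝ) (hz : 1 < z)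
    (hp2 : ∀ p ∈ s.prodPrimes.primeFactors, s.nu p = 2 / p)
    (hpz : ∀ p ∈ s.prodPrimes.primeFactors, (p : ℝ) ≤ z) :
    (1 / 2) * ∏ p ∈ s.prodPrimes.primeFactors, (1 - 2 / (p : ℝ))⁻¹ ≤ selS s (z ^ 9) := by
  have hlz : 0 < Real.log z := Real.log_pos hz
  set η : ℝ := 1 / Real.log z with hη
  have hη0 : 0 < η := by positivity
  set Q := s.prodPrimes with hQ
  have hQsq : Squarefree Q := s.prodPrimes_squarefree
  have hnu : ∀ p ∈ Q.primeFactors, 0 < s.nu p ∧ s.nu p < 1 := fun p hp =>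
    ⟨s.nu_pos_of_prime p (Nat.prime_of_mem_primeFactors hp) (Nat.dvd_of_mem_primeFactors hp),
     s.nu_lt_one_of_prime p (Nat.prime_of_mem_primeFactors hp) (Nat.dvd_of_mem_primeFactors hp)⟩
  have hgp : ∀ p ∈ Q.primeFactors, s.selbergTerms p = s.nu p * (1 - s.nu p)⁻¹ := by
    intro p hp
    rw [selbergTerms_apply, (Nat.prime_of_mem_primeFactors hp).primeFactors]
    simp
  have hg1 : ∀ p ∈ Q.primeFactors, 1 + s.selbergTerms p = (1 - s.nu p)⁻¹ := by
    intro p hp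
    rw [hgp p hp]
    have := (hnu p hp).2
    have h1 : (1 - s.nu p) ≠ 0 := by linarith
    field_simp
    ring
  -- total
  have hT : ∏ p ∈ Q.primeFactors, (1 - 2 / (p : ℝ))⁻¹ = ∑ d ∈ Q.divisors, s.selbergTerms d := by
    rw [← selbergTerms_isMultiplicative.prodPrimeFactors_one_add_of_squarefree hQsq]
    apply prod_congr rfl
    intro p hp
    rw [hg1 p hp, hp2 p hp]
  let F : ArithmeticFunction ℝ := ⟨fun n => s.selbergTerms n * (n : ℝ) ^ η, by simp⟩
  have hF : ∀ n, F n = s.selbergTerms n * (n : ℝ) ^ η := fun n => rfl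
  have hFm : F.IsMultiplicative := by
    constructor
    · rw [hF, selbergTerms_isMultiplicative.1]; simp
    · intro m n hmn
      rw [hF, hF, hF, selbergTerms_isMultiplicative.2 hmn]
      push_cast
      rw [Real.mul_rpow (by positivity) (by positivity)]
      ring
  have hFsum := hFm.prodPrimeFactors_one_add_of_squarefree hQsq
  have hlogp : ∀ p ∈ Q.primeFactors, 0 ≤ Real.log p ∧ Real.log p ≤ Real.log z := by
    intro p hp
    have h1 : (1 : ℝ) ≤ p := by exact_mod_cast (Nat.prime_of_mem_primeFactors hp).one_lt.le
    exact ⟨Real.log_nonneg h1, Real.log_le_log (by linarith) (hpz p hp)⟩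
  have hprod : ∏ p ∈ Q.primeFactors, (1 + F p) ≤
      (∏ p ∈ Q.primeFactors, (1 - 2 / (p : ℝ))⁻¹) *
        Real.exp (∑ p ∈ Q.primeFactors, (2 / (p : ℝ)) * (2 * (η * Real.log p))) := by
    apply prod_rankin
    · intro p hp
      rw [hF, hgp p hp]
      have := (hnu p hp).1
      have h2 : 0 ≤ (1 - s.nu p)⁻¹ := inv_nonneg.2 (by linarith [(hnu p hp).2])
      positivity
    · intro p hp
      have h1 : (0 : ℝ) < p := by exact_mod_cast (Nat.prime_of_mem_primeFactors hp).pos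
      have hpe : (p : ℝ) ^ η ≤ 1 + 2 * (η * Real.log p) := by
        rw [Real.rpow_def_of_pos h1, mul_comm]
        have ht0 : 0 ≤ η * Real.log p := mul_nonneg hη0.le (hlogp p hp).1
        have ht1 : η * Real.log p ≤ 1 := by
          rw [hη, one_div, inv_mul_le_iff₀ hlz]
          linarith [(hlogp p hp).2]
        linarith [exp_sub_one_le_two_mul ht0 ht1]
      rw [hF, hgp p hp, ← hp2 p hp]
      have hn := hnu p hp
      have h2 : 0 < (1 - s.nu p)⁻¹ := inv_pos.2 (by linarith)
      have e1 : 1 + s.nu p * (1 - s.nu p)⁻¹ * (p : ℝ) ^ η =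
          (1 - s.nu p)⁻¹ * (1 + s.nu p * ((p : ℝ) ^ η - 1)) := by
        have : (1 - s.nu p) ≠ 0 := by linarith
        field_simp
        ring
      rw [e1]
      apply mul_le_mul_of_nonneg_left _ h2.le
      have h3 := Real.add_one_le_exp (s.nu p * (2 * (η * Real.log p)))
      have h4 : s.nu p * ((p : ℝ) ^ η - 1) ≤ s.nu p * (2 * (η * Real.log p)) :=
        mul_le_mul_of_nonneg_left (by linarith) hn.1.le
      linarith
  have hsum8 : ∑ p ∈ Q.primeFactors, (2 / (p : ℝ)) * (2 * (η * Real.log p)) ≤ 8 := by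
    have e1 : ∑ p ∈ Q.primeFactors, (2 / (p : ℝ)) * (2 * (η * Real.log p)) =
        4 * η * ∑ p ∈ Q.primeFactors, Real.log p / p := by
      rw [mul_sum]
      apply sum_congr rfl
      intro p _
      ring
    rw [e1]
    have h1 : ∑ p ∈ Q.primeFactors, Real.log p / p ≤ ∑ p ∈ Nat.primesLE ⌊z⌋₊, Real.log p / p := by
      apply sum_le_sum_of_subset_of_nonneg
      · intro p hp
        rw [Nat.mem_primesLE]
        exact ⟨Nat.le_floor (hpz p hp), Nat.prime_of_mem_primeFactors hp⟩
      · intro p hp _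
        have := (Nat.mem_primesLE.1 hp).2.one_lt.le
        exact div_nonneg (Real.log_nonneg (by exact_mod_cast this)) (by positivity)
    have h2 := mertens_one ⌊z⌋₊
    have h3 : Real.log (⌊z⌋₊ : ℝ) ≤ Real.log z := by
      apply Real.log_le_log
      · exact_mod_cast Nat.floor_pos.2 hz.le
      · exact Nat.floor_le (by linarith)
    calc 4 * η * ∑ p ∈ Q.primeFactors, Real.log p / p ≤ 4 * η * (2 * Real.log z) := by
          apply mul_le_mul_of_nonneg_left _ (by positivity)
          linarith
      _ = 8 := by rw [hη]; field_simp; norm_num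
  set T := ∏ p ∈ Q.primeFactors, (1 - 2 / (p : ℝ))⁻¹ with hTdef
  have hT0 : 0 ≤ T := by
    rw [hT]
    exact sum_nonneg (fun d hd => (selbergTerms_pos (Nat.dvd_of_mem_divisors hd)).le)
  have hFT : ∑ d ∈ Q.divisors, F d ≤ T * Real.exp 8 := by
    rw [← hFsum]
    refine hprod.trans ?_
    apply mul_le_mul_of_nonneg_left _ hT0
    exact Real.exp_le_exp.2 hsum8
  have hsplit := sum_filter_add_sum_filter_not Q.divisors (fun l : ℕ => (l : ℝ) ≤ z ^ 9) (fun d => s.selbergTerms d)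
  have htail : ∑ d ∈ Q.divisors.filter (fun l : ℕ => ¬ (l : ℝ) ≤ z ^ 9), s.selbergTerms d ≤
      Real.exp (-9) * (T * Real.exp 8) := by
    calc _ ≤ ∑ d ∈ Q.divisors.filter (fun l : ℕ => ¬ (l : ℝ) ≤ z ^ 9), Real.exp (-9) * F d := by
          apply sum_le_sum
          intro d hd
          rw [mem_filter] at hd
          have hg := selbergTerms_pos (s := s) (Nat.dvd_of_mem_divisors hd.1)
          rw [hF]
          have h9 : Real.exp 9 ≤ (d : ℝ) ^ η := by
            have hz0 : 0 < z := by linarith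
            have : Real.exp 9 = (z ^ 9) ^ η := by
              rw [Real.rpow_def_of_pos (by positivity), Real.log_pow, hη]
              congr 1
              field_simp
              norm_num
            rw [this]
            exact Real.rpow_le_rpow (by positivity) (by linarith [hd.2]) hη0.le
          have : 1 ≤ Real.exp (-9) * (d : ℝ) ^ η := by
            rw [Real.exp_neg, ← div_eq_inv_mul, le_div_iff₀ (Real.exp_pos _)]
            linarith
          nlinarith
      _ = Real.exp (-9) * ∑ d ∈ Q.divisors.filter (fun l : ℕ => ¬ (l : ℝ) ≤ z ^ 9), F d := by
          rw [mul_sum]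
      _ ≤ Real.exp (-9) * ∑ d ∈ Q.divisors, F d := by
          apply mul_le_mul_of_nonneg_left _ (Real.exp_pos _).le
          apply sum_le_sum_of_subset_of_nonneg (filter_subset _ _)
          intro d hd _
          rw [hF]
          have hg := selbergTerms_pos (s := s) (Nat.dvd_of_mem_divisors hd)
          positivity
      _ ≤ _ := mul_le_mul_of_nonneg_left hFT (Real.exp_pos _).le
  have hexp : Real.exp (-9) * (T * Real.exp 8) ≤ 1 / 2 * T := by
    have e1 : Real.exp (-9) * (T * Real.exp 8) = T * Real.exp (-1) := by
      rw [mul_comm, mul_assoc, ← Real.exp_add]; norm_num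
    rw [e1, mul_comm (1 / 2 : ℝ)]
    apply mul_le_mul_of_nonneg_left _ hT0
    rw [Real.exp_neg]
    have := Real.add_one_le_exp (1 : ℝ)
    rw [inv_le_comm₀ (Real.exp_pos _) (by norm_num)]
    linarith
  have : selS s (z ^ 9) = ∑ d ∈ Q.divisors.filter (fun l : ℕ => (l : ℝ) ≤ z ^ 9), s.selbergTerms d := rfl
  rw [this]
  linarith [hT]

/-- the local factor -/
noncomputable def HH (n : ℕ) : ℝ := ∏ p ∈ n.primeFactors, ((1 - (p : ℝ)⁻¹)⁻¹) ^ 2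

theorem one_le_hp {p : ℕ} (hp : p.Prime) : 1 ≤ (1 - (p : ℝ)⁻¹)⁻¹ := by
  have h2 : (2 : ℝ) ≤ p := by exact_mod_cast hp.two_le
  have h3 : (p : ℝ)⁻¹ ≤ 2⁻¹ := inv_anti₀ (by norm_num) h2
  have h4 : 0 < (p : ℝ)⁻¹ := by positivity
  rw [one_le_inv₀ (by linarith)]
  linarith

theorem one_le_prod_aux {s : Finset ℕ} {f : ℕ → ℝ} (h : ∀ i ∈ s, 1 ≤ f i) : 1 ≤ ∏ i ∈ s, f i := by
  have := prod_le_prod (s := s) (f := fun _ => (1 : ℝ)) (g := f) (fun _ _ => zero_le_one) h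
  simpa using this

theorem one_le_HH (n : ℕ) : 1 ≤ HH n := by
  unfold HH
  apply one_le_prod_aux
  intro p hp
  exact one_le_pow₀ (one_le_hp (Nat.prime_of_mem_primeFactors hp))

theorem HH_mul {a b : ℕ} (h : a.Coprime b) : HH (a * b) = HH a * HH b := by
  unfold HH
  rw [h.primeFactors_mul, prod_union h.disjoint_primeFactors]

theorem sieve_count (a b M : ℕ) (ha : 0 < a) (hb : 0 < b) (hab : a.Coprime b) (z : ℝ) (hz : 1 < z)
    (A : Finset ℕ) (hA : ∀ n ∈ A, n ∈ Ioc 0 M ∧ (a ∣ n ∧ b ∣ n + 1) ∧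
      ∀ q : ℕ, q.Prime → 2 < q → (q : ℝ) ≤ z → ¬ q ∣ a * b → ¬ q ∣ n * (n + 1)) :
    (A.card : ℝ) ≤
      (M : ℝ) / (a * b) * (8 * HH (a * b) / (Real.log z) ^ 2) + z ^ 54 := by
  classical
  set P := (Nat.primesLE ⌊z⌋₊).filter (fun p => 2 < p ∧ ¬ p ∣ a * b) with hPdef
  have hmem : ∀ p, p ∈ P ↔ (p : ℝ) ≤ z ∧ p.Prime ∧ 2 < p ∧ ¬ p ∣ a * b := by
    intro p
    rw [hPdef, mem_filter, Nat.mem_primesLE, Nat.le_floor_iff (by linarith), and_assoc]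
  have hP : ∀ p ∈ P, p.Prime ∧ 2 < p := fun p hp => ⟨((hmem p).1 hp).2.1, ((hmem p).1 hp).2.2.1⟩
  have hPab : ∀ p ∈ P, ¬ p ∣ a * b := fun p hp => ((hmem p).1 hp).2.2.2
  have hz9 : 1 ≤ z ^ 9 := one_le_pow₀ hz.le
  have hb1 := mySieve_bound a b M ha hb hab P hP hPab (z ^ 9) hz9
  have hlz : 0 < Real.log z := Real.log_pos hz
  have hpf : (mySieve a b M P hP).prodPrimes.primeFactors = P := by
    change (∏ p ∈ P, p).primeFactors = P
    exact Nat.primeFactors_prod (fun p hp => (hP p hp).1)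
  have hr := rankin_sel (mySieve a b M P hP) z hz (by
      rw [hpf]; intro p hp; exact nuA_prime (hP p hp).1) (by
      rw [hpf]; intro p hp; exact ((hmem p).1 hp).1)
  rw [hpf] at hr
  -- lower bound for product
  have hsq : ∏ p ∈ P, ((1 - (p : ℝ)⁻¹)⁻¹) ^ 2 ≤ ∏ p ∈ P, (1 - 2 / (p : ℝ))⁻¹ := by
    apply prod_le_prod
    · intro p hp; positivity
    · intro p hp
      have h2 : (2 : ℝ) < p := by exact_mod_cast (hP p hp).2
      have h3 : 2 / (p : ℝ) < 1 := by rw [div_lt_one (by linarith)]; exact h2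
      rw [inv_pow]
      apply inv_anti₀ (by linarith)
      have : (2 / (p : ℝ)) = 2 * (p : ℝ)⁻¹ := by ring
      rw [this]
      nlinarith [sq_nonneg ((p : ℝ)⁻¹)]
  have hfull : (Real.log z) ^ 2 ≤ (∏ p ∈ P, ((1 - (p : ℝ)⁻¹)⁻¹) ^ 2) * (4 * HH (a * b)) := by
    have h1 : Real.log z ≤ ∏ p ∈ Nat.primesLE ⌊z⌋₊, (1 - (p : ℝ)⁻¹)⁻¹ := by
      refine le_trans ?_ (euler_prod_lower ⌊z⌋₊)
      exact Real.log_le_log (by linarith) (Nat.lt_floor_add_one z).le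
    have h2 : (Real.log z) ^ 2 ≤ ∏ p ∈ Nat.primesLE ⌊z⌋₊, ((1 - (p : ℝ)⁻¹)⁻¹) ^ 2 := by
      rw [prod_pow]
      exact pow_le_pow_left₀ hlz.le h1 2
    refine h2.trans ?_
    have hsub : Nat.primesLE ⌊z⌋₊ ⊆ P ∪ ({2} ∪ (a * b).primeFactors) := by
      intro p hp
      rw [Nat.mem_primesLE, Nat.le_floor_iff (by linarith)] at hp
      simp only [mem_union, mem_singleton]
      by_cases h : p ∈ P
      · exact Or.inl h
      · right
        by_contra hc
        push Not at hc
        apply h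
        rw [hmem]
        have := hp.2.two_le
        refine ⟨hp.1, hp.2, by omega, fun hd => hc.2 ?_⟩
        exact Nat.mem_primeFactors.2 ⟨hp.2, hd, by positivity⟩
    have hprime : ∀ p ∈ P ∪ ({2} ∪ (a * b).primeFactors), p.Prime := by
      intro p hp
      simp only [mem_union, mem_singleton] at hp
      rcases hp with h | h | h
      · exact (hP p h).1
      · rw [h]; exact Nat.prime_two
      · exact Nat.prime_of_mem_primeFactors h
    have key : ∀ S T : Finset ℕ, (∀ p ∈ S ∪ T, p.Prime) →
        ∏ p ∈ S ∪ T, ((1 - (p : ℝ)⁻¹)⁻¹) ^ 2 ≤ (∏ p ∈ S, ((1 - (p : ℝ)⁻¹)⁻¹) ^ 2) * ∏ p ∈ T, ((1 - (p : ℝ)⁻¹)⁻¹) ^ 2 := by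
      intro S T h
      rw [← prod_union_inter]
      apply le_mul_of_one_le_right
      · exact prod_nonneg (fun p _ => by positivity)
      · apply one_le_prod_aux
        intro p hp
        exact one_le_pow₀ (one_le_hp (h p (by
          rw [mem_inter] at hp; exact mem_union_left _ hp.1)))
    calc ∏ p ∈ Nat.primesLE ⌊z⌋₊, ((1 - (p : ℝ)⁻¹)⁻¹) ^ 2
        ≤ ∏ p ∈ P ∪ ({2} ∪ (a * b).primeFactors), ((1 - (p : ℝ)⁻¹)⁻¹) ^ 2 := by
          rw [← prod_sdiff hsub]
          apply le_mul_of_one_le_left (prod_nonneg (fun p _ => by positivity))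
          apply one_le_prod_aux
          intro p hp
          exact one_le_pow₀ (one_le_hp (hprime p (mem_sdiff.1 hp).1))
      _ ≤ (∏ p ∈ P, ((1 - (p : ℝ)⁻¹)⁻¹) ^ 2) * ∏ p ∈ ({2} ∪ (a * b).primeFactors), ((1 - (p : ℝ)⁻¹)⁻¹) ^ 2 :=
          key _ _ hprime
      _ ≤ _ := by
          apply mul_le_mul_of_nonneg_left _ (prod_nonneg (fun p _ => by positivity))
          refine (key _ _ (fun p hp => hprime p (mem_union_right _ hp))).trans ?_
          unfold HH
          rw [prod_singleton]
          norm_num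
  have hHpos : 0 < HH (a * b) := lt_of_lt_of_le one_pos (one_le_HH _)
  have hS : Real.log z ^ 2 / (8 * HH (a * b)) ≤ selS (mySieve a b M P hP) (z ^ 9) := by
    rw [div_le_iff₀ (by positivity)]
    nlinarith
  have hSinv : (selS (mySieve a b M P hP) (z ^ 9))⁻¹ ≤ 8 * HH (a * b) / (Real.log z) ^ 2 := by
    rw [← inv_div]
    exact inv_anti₀ (by positivity) hS
  have hcard : (A.card : ℝ) ≤
      (((Ioc 0 M).filter (fun n => (a ∣ n ∧ b ∣ n + 1) ∧ ∀ p ∈ P, ¬ p ∣ n * (n + 1))).card : ℝ) := by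
    norm_cast
    apply card_le_card
    intro n hn
    replace hn := hA n hn
    rw [mem_filter]
    refine ⟨hn.1, hn.2.1, fun p hp => ?_⟩
    have := (hmem p).1 hp
    exact hn.2.2 p this.2.1 this.2.2.1 this.1 this.2.2.2
  refine hcard.trans (hb1.trans ?_)
  have e6 : (z ^ 9) ^ 6 = z ^ 54 := by rw [← pow_mul]
  rw [e6]
  gcongr

/-- the sieve bound in the form used later -/
theorem sieve_final (a b M : ℕ) (ha : 0 < a) (hb : 0 < b) (hab : a.Coprime b) (y : ℝ) (hy : 1 < y)
    (hX : y ^ (1 / 2 : ℝ) ≤ (M : ℝ) / (a * b))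
    (A : Finset ℕ) (hA : ∀ n ∈ A, n ∈ Ioc 0 M ∧ (a ∣ n ∧ b ∣ n + 1) ∧
      ∀ q : ℕ, q.Prime → (q : ℝ) ^ 2 < y → ¬ q ∣ a * b → ¬ q ∣ n * (n + 1)) :
    (A.card : ℝ) ≤
      (8 * 216 ^ 2 + 64) * HH (a * b) * ((M : ℝ) / (a * b)) / (Real.log y) ^ 2 := by
  classical
  have hy0 : 0 < y := by linarith
  set z := y ^ (1 / 216 : ℝ) with hzdef
  have hz : 1 < z := Real.one_lt_rpow hy (by norm_num)
  have h := sieve_count a b M ha hb hab z hz A (by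
    intro n hn
    replace hn := hA n hn
    refine ⟨hn.1, hn.2.1, fun q hq h2 hqz => hn.2.2 q hq ?_⟩
    calc (q : ℝ) ^ 2 ≤ z ^ 2 := pow_le_pow_left₀ (by positivity) hqz 2
      _ = y ^ (1 / 108 : ℝ) := by
        rw [hzdef, ← Real.rpow_natCast, ← Real.rpow_mul hy0.le]; norm_num
      _ < y := by
        conv_rhs => rw [← Real.rpow_one y]
        exact Real.rpow_lt_rpow_of_exponent_lt hy (by norm_num))
  have hly : 0 < Real.log y := Real.log_pos hy
  have hlz : Real.log z = Real.log y / 216 := by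
    rw [hzdef, Real.log_rpow hy0]; ring
  have hz54 : z ^ 54 = y ^ (1 / 4 : ℝ) := by
    rw [hzdef, ← Real.rpow_natCast, ← Real.rpow_mul hy0.le]; norm_num
  refine h.trans ?_
  rw [hz54, hlz]
  have hH := one_le_HH (a * b)
  have hlog : (Real.log y) ^ 2 ≤ 64 * y ^ (1 / 4 : ℝ) := by
    have h1 := Real.log_le_rpow_div hy0.le (ε := 1 / 8) (by norm_num)
    have h2 : (Real.log y) ^ 2 ≤ (y ^ (1 / 8 : ℝ) / (1 / 8)) ^ 2 := pow_le_pow_left₀ hly.le h1 2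
    have h3 : (y ^ (1 / 8 : ℝ)) ^ 2 = y ^ (1 / 4 : ℝ) := by
      rw [← Real.rpow_natCast, ← Real.rpow_mul hy0.le]; norm_num
    rw [div_pow, h3] at h2
    refine h2.trans (le_of_eq ?_)
    rw [div_eq_iff (by norm_num)]
    ring
  set X := (M : ℝ) / (a * b)
  have hy4 : 0 < y ^ (1 / 4 : ℝ) := Real.rpow_pos_of_pos hy0 _
  have hyy : y ^ (1 / 4 : ℝ) * y ^ (1 / 4 : ℝ) = y ^ (1 / 2 : ℝ) := by
    rw [← Real.rpow_add hy0]; norm_num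
  have h5 : y ^ (1 / 4 : ℝ) ≤ 64 * HH (a * b) * X / (Real.log y) ^ 2 := by
    rw [le_div_iff₀ (by positivity)]
    have hX0 : 0 ≤ X := le_trans (by positivity) hX
    calc y ^ (1 / 4 : ℝ) * Real.log y ^ 2 ≤ y ^ (1 / 4 : ℝ) * (64 * y ^ (1 / 4 : ℝ)) := by gcongr
      _ = 64 * y ^ (1 / 2 : ℝ) := by rw [← hyy]; ring
      _ ≤ 64 * X := by linarith
      _ ≤ 64 * HH (a * b) * X := by nlinarith
  have e : X * (8 * HH (a * b) / (Real.log y / 216) ^ 2) + 64 * HH (a * b) * X / (Real.log y) ^ 2 =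
      (8 * 216 ^ 2 + 64) * HH (a * b) * X / (Real.log y) ^ 2 := by
    field_simp
  linarith

end P4

section P5
open Finset

theorem poisson_le (T : ℝ) (hT : 1 ≤ T) (k : ℕ) : T ^ k / k.factorial ≤ Real.exp T / √T := by
  have hT0 : 0 < T := by linarith
  have big : ∀ m : ℕ, T / 2 ≤ m → T ^ m / m.factorial ≤ Real.exp T / √T := by
    intro m hm
    have hm0 : (0 : ℝ) < m := by linarith
    have hst := Stirling.le_factorial_stirling m
    have h1 : √T ≤ √(2 * Real.pi * m) := by
      apply Real.sqrt_le_sqrt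
      have := Real.pi_gt_three
      nlinarith
    have h2 : T ^ m ≤ Real.exp T * ((m : ℝ) / Real.exp 1) ^ m := by
      have h3 : T / m ≤ Real.exp (T / m - 1) := by
        have := Real.add_one_le_exp (T / m - 1)
        linarith
      have h4 : (T / m) ^ m ≤ Real.exp (T - m) := by
        calc (T / m) ^ m ≤ (Real.exp (T / m - 1)) ^ m := pow_le_pow_left₀ (by positivity) h3 m
          _ = Real.exp (T - m) := by
            rw [← Real.exp_nat_mul]; congr 1; field_simp
      have e1 : ((m : ℝ) / Real.exp 1) ^ m = (m : ℝ) ^ m * Real.exp (-m) := by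
        rw [div_pow, ← Real.exp_nat_mul, mul_one, Real.exp_neg]; rfl
      have e2 : Real.exp T * ((m : ℝ) ^ m * Real.exp (-m)) = Real.exp (T - m) * (m : ℝ) ^ m := by
        rw [sub_eq_add_neg, Real.exp_add]; ring
      rw [e1, e2]
      rw [div_pow, div_le_iff₀ (by positivity)] at h4
      exact h4
    have hsT : 0 < √T := Real.sqrt_pos.2 hT0
    rw [div_le_div_iff₀ (by positivity) hsT]
    calc T ^ m * √T ≤ (Real.exp T * ((m : ℝ) / Real.exp 1) ^ m) * √(2 * Real.pi * m) := by gcongr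
      _ = Real.exp T * (√(2 * Real.pi * m) * ((m : ℝ) / Real.exp 1) ^ m) := by ring
      _ ≤ _ := by gcongr
  by_cases hk : T / 2 ≤ k
  · exact big k hk
  · push Not at hk
    set m := ⌊T⌋₊ with hm
    have hmT : (m : ℝ) ≤ T := Nat.floor_le hT0.le
    have hm1 : T < m + 1 := Nat.lt_floor_add_one T
    have hm2 : 1 ≤ m := Nat.le_floor (by simpa using hT)
    have hm3 : (1 : ℝ) ≤ m := by exact_mod_cast hm2
    have hkm : k ≤ m := Nat.le_floor (by linarith)
    refine le_trans ?_ (big m (by linarith))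
    have mono : ∀ i, k ≤ i → i ≤ m → T ^ k / k.factorial ≤ T ^ i / i.factorial := by
      intro i hi
      induction i, hi using Nat.le_induction with
      | base => intro _; exact le_rfl
      | succ i hi ih =>
        intro him
        refine (ih (by omega)).trans ?_
        have : ((i + 1 : ℕ) : ℝ) ≤ T := le_trans (by exact_mod_cast him) hmT
        rw [pow_succ, Nat.factorial_succ, div_le_div_iff₀ (by positivity) (by positivity)]
        push_cast at this ⊢
        have : 0 ≤ T ^ i * (i.factorial : ℝ) := by positivity
        nlinarith
    exact mono m hkm le_rfl

theorem pow_step (S G : ℝ) (hS : 0 ≤ S) (hG : 0 ≤ G) (j : ℕ) :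
    S ^ (j + 1) + (j + 1) * G * S ^ j ≤ (S + G) ^ (j + 1) := by
  induction j with
  | zero => simp
  | succ j ih =>
    have h1 := mul_le_mul_of_nonneg_right ih (add_nonneg hS hG)
    rw [← pow_succ] at h1
    refine le_trans ?_ h1
    push_cast
    have : 0 ≤ (j + 1 : ℝ) * G * S ^ j * G := by positivity
    have e : (S ^ (j + 1) + (↑j + 1) * G * S ^ j) * (S + G) =
      S ^ (j + 1 + 1) + (↑j + 1 + 1) * G * S ^ (j + 1) + (j + 1 : ℝ) * G * S ^ j * G := by ring
    rw [e]; linarith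

theorem anatomy_induct (f : ℕ → ℝ) (h r : ℕ → ℝ) (f1 : f 1 = 1) (hf0 : ∀ n, 0 ≤ f n)
    (hh0 : ∀ p, p.Prime → 0 ≤ h p) (hr0 : ∀ p, p.Prime → 0 ≤ r p) (hr1 : ∀ p, p.Prime → r p < 1)
    (hf : ∀ p i m, p.Prime → 1 ≤ i → ¬ p ∣ m → f (p ^ i * m) = h p * r p ^ i * f m)
    (P : Finset ℕ) :
    (∀ p ∈ P, p.Prime) → ∀ (j : ℕ) (A : Finset ℕ),
      (∀ a ∈ A, a ≠ 0 ∧ a.primeFactors ⊆ P ∧ a.primeFactors.card = j) →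
      ∑ a ∈ A, f a ≤ (∑ p ∈ P, h p * (r p / (1 - r p))) ^ j / j.factorial := by
  classical
  induction P using Finset.induction_on with
  | empty =>
    intro _ j A hA
    have hA1 : A ⊆ {1} := by
      intro a ha
      obtain ⟨h0, h1, _⟩ := hA a ha
      rw [subset_empty, Nat.primeFactors_eq_empty] at h1
      simp; omega
    rcases j with _ | j
    · simp
      calc ∑ a ∈ A, f a ≤ ∑ a ∈ {1}, f a := sum_le_sum_of_subset_of_nonneg hA1 (fun _ _ _ => hf0 _)
        _ = 1 := by simp [f1]
    · have : A = ∅ := by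
        rw [eq_empty_iff_forall_notMem]
        intro a ha
        have h1 := hA1 ha
        rw [mem_singleton] at h1
        have := (hA a ha).2.2
        rw [h1] at this
        simp at this
      rw [this]
      simp
  | insert p P hpP ih =>
    intro hP j A hA
    have hp : p.Prime := hP p (mem_insert_self _ _)
    have hP' : ∀ q ∈ P, q.Prime := fun q hq => hP q (mem_insert_of_mem hq)
    replace ih := ih hP'
    set S := ∑ q ∈ P, h q * (r q / (1 - r q)) with hSdef
    have hG0 : ∀ q, q.Prime → 0 ≤ h q * (r q / (1 - r q)) := fun q hq =>
      mul_nonneg (hh0 q hq) (div_nonneg (hr0 q hq) (by linarith [hr1 q hq]))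
    have hS0 : 0 ≤ S := sum_nonneg (fun q hq => hG0 q (hP' q hq))
    rw [sum_insert hpP, add_comm]
    set G := h p * (r p / (1 - r p)) with hG
    have hGp : 0 ≤ G := hG0 p hp
    rw [← sum_filter_add_sum_filter_not A (fun a => ¬ p ∣ a)]
    have hA0 : ∑ a ∈ A.filter (fun a => ¬ p ∣ a), f a ≤ S ^ j / j.factorial := by
      apply ih
      intro a ha
      rw [mem_filter] at ha
      obtain ⟨h0, h1, h2⟩ := hA a ha.1
      refine ⟨h0, ?_, h2⟩
      intro q hq
      rcases mem_insert.1 (h1 hq) with h | h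
      · exact absurd (h ▸ Nat.dvd_of_mem_primeFactors hq) ha.2
      · exact h
    rcases j with _ | j
    · have : A.filter (fun a => ¬ ¬ p ∣ a) = ∅ := by
        rw [filter_eq_empty_iff]
        intro a ha hd
        obtain ⟨h0, h1, h2⟩ := hA a ha
        rw [card_eq_zero] at h2
        have : p ∈ a.primeFactors := Nat.mem_primeFactors.2 ⟨hp, not_not.1 hd, h0⟩
        rw [h2] at this
        simp at this
      rw [this, sum_empty, add_zero]
      simpa using hA0
    · have hA1 : ∑ a ∈ A.filter (fun a => ¬ ¬ p ∣ a), f a ≤ G * (S ^ j / j.factorial) := by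
        set B := A.filter (fun a => ¬ ¬ p ∣ a) with hB
        have hBm : ∀ a ∈ B, a ∈ A ∧ p ∣ a := by
          intro a ha
          rw [hB, mem_filter, not_not] at ha
          exact ha
        have hSj : 0 ≤ S ^ j / (j.factorial : ℝ) := by positivity
        rw [← sum_fiberwise_of_maps_to (g := fun a => a.factorization p) (t := B.image (fun a => a.factorization p))
          (fun a ha => mem_image_of_mem _ ha)]
        have hfib : ∀ i ∈ B.image (fun a => a.factorization p),
            ∑ a ∈ B.filter (fun a => a.factorization p = i), f a ≤ h p * r p ^ i * (S ^ j / j.factorial) := by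
          intro i hi
          have hi1 : 1 ≤ i := by
            obtain ⟨a, ha, rfl⟩ := mem_image.1 hi
            obtain ⟨h1, h2⟩ := hBm a ha
            exact (hp.dvd_iff_one_le_factorization (hA a h1).1).1 h2
          have hdec : ∀ a ∈ B.filter (fun a => a.factorization p = i), ¬ p ∣ a / p ^ i ∧ a = p ^ i * (a / p ^ i) := by
            intro a ha
            rw [mem_filter] at ha
            obtain ⟨h1, h2⟩ := hBm a ha.1
            have h0 := (hA a h1).1
            rw [← ha.2]
            exact ⟨Nat.not_dvd_ordCompl hp h0, (Nat.ordProj_mul_ordCompl_eq_self a p).symm⟩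
          have e1 : ∑ a ∈ B.filter (fun a => a.factorization p = i), f a =
              h p * r p ^ i * ∑ m ∈ (B.filter (fun a => a.factorization p = i)).image (fun a => a / p ^ i), f m := by
            rw [sum_image, mul_sum]
            · apply sum_congr rfl
              intro a ha
              obtain ⟨h1, h2⟩ := hdec a ha
              conv_lhs => rw [h2]
              exact hf p i _ hp hi1 h1
            · intro a ha b hb hab
              rw [(hdec a ha).2, (hdec b hb).2]
              simp only at hab
              rw [hab]
          rw [e1]
          apply mul_le_mul_of_nonneg_left _ (mul_nonneg (hh0 p hp) (pow_nonneg (hr0 p hp) _))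
          apply ih
          intro m hm
          obtain ⟨a, ha, rfl⟩ := mem_image.1 hm
          obtain ⟨h1, h2⟩ := hdec a ha
          rw [mem_filter] at ha
          obtain ⟨g0, g1, g2⟩ := hA a (hBm a ha.1).1
          set m := a / p ^ i
          have hm0 : m ≠ 0 := by
            intro h; rw [h] at h1; simp at h1
          have hpfa : a.primeFactors = insert p m.primeFactors := by
            rw [h2, Nat.primeFactors_mul (pow_ne_zero _ hp.ne_zero) hm0, Nat.primeFactors_prime_pow (by omega) hp]
            rfl
          have hpm : p ∉ m.primeFactors := fun h => h1 (Nat.dvd_of_mem_primeFactors h)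
          refine ⟨hm0, ?_, ?_⟩
          · intro q hq
            have : q ∈ a.primeFactors := by rw [hpfa]; exact mem_insert_of_mem hq
            rcases mem_insert.1 (g1 this) with h | h
            · rw [h] at hq; exact absurd hq hpm
            · exact h
          · rw [hpfa, card_insert_of_notMem hpm] at g2
            omega
        refine (sum_le_sum hfib).trans ?_
        rw [← sum_mul]
        apply mul_le_mul_of_nonneg_right _ hSj
        rw [← mul_sum, hG]
        apply mul_le_mul_of_nonneg_left _ (hh0 p hp)
        set I := B.image (fun a => a.factorization p) with hI
        have hIsub : I ⊆ Ico 1 (I.sup id + 1) := by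
          intro i hi
          rw [mem_Ico]
          refine ⟨?_, Nat.lt_succ_of_le (le_sup (f := id) hi)⟩
          obtain ⟨a, ha, rfl⟩ := mem_image.1 hi
          obtain ⟨h1, h2⟩ := hBm a ha
          exact (hp.dvd_iff_one_le_factorization (hA a h1).1).1 h2
        have := geom_sum_Ico_le_of_lt_one (m := 1) (n := I.sup id + 1) (hr0 p hp) (hr1 p hp)
        rw [pow_one] at this
        refine le_trans ?_ this
        exact sum_le_sum_of_subset_of_nonneg hIsub (fun i _ _ => pow_nonneg (hr0 p hp) _)
      have h3 := pow_step S G hS0 hGp j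
      have e4 : S ^ (j + 1) / ((j + 1).factorial : ℝ) + G * (S ^ j / j.factorial) =
          (S ^ (j + 1) + (j + 1) * G * S ^ j) / ((j + 1).factorial : ℝ) := by
        rw [Nat.factorial_succ]
        push_cast
        field_simp
      calc _ ≤ S ^ (j + 1) / ((j + 1).factorial : ℝ) + G * (S ^ j / j.factorial) := add_le_add hA0 hA1
        _ = _ := e4
        _ ≤ _ := by gcongr

theorem G_bound (p : ℕ) (hp : p.Prime) (t : ℝ) (ht0 : 0 ≤ t) (ht1 : t ≤ 1 / 4) :
    Real.exp t / p < 1 ∧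
    ((1 - (p : ℝ)⁻¹)⁻¹) ^ 2 * ((Real.exp t / p) / (1 - Real.exp t / p)) ≤
      (p : ℝ)⁻¹ + 2 * t / p + 32 * ((p : ℝ) ^ 2)⁻¹ := by
  have h2 : (2 : ℝ) ≤ p := by exact_mod_cast hp.two_le
  set x : ℝ := (p : ℝ)⁻¹ with hx
  have hx0 : 0 < x := by positivity
  have hx1 : x ≤ 1 / 2 := by rw [hx, one_div]; exact inv_anti₀ (by norm_num) h2
  have hexp : Real.exp t ≤ 1 + t + t ^ 2 := by
    have := Real.abs_exp_sub_one_sub_id_le (x := t) (by rw [abs_of_nonneg ht0]; linarith)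
    linarith [(abs_le.1 this).2]
  have hE2 : Real.exp t ≤ 1 + 2 * t := by nlinarith
  have hE3 : Real.exp t ≤ 21 / 16 := by nlinarith
  have hE0 : 0 < Real.exp t := Real.exp_pos t
  set E := Real.exp t
  have er : E / p = E * x := by rw [hx]; rfl
  have hr : E * x ≤ 21 / 32 := by nlinarith
  have hr0 : 0 < E * x := by positivity
  have e2 : ((p : ℝ) ^ 2)⁻¹ = x ^ 2 := by rw [hx, inv_pow]
  have e3 : 2 * t / (p : ℝ) = 2 * t * x := by rw [hx]; rfl
  rw [er, e2, e3]
  refine ⟨by linarith, ?_⟩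
  have hh : ((1 - x)⁻¹) ^ 2 ≤ 1 + 6 * x := by
    rw [inv_pow, inv_le_iff_one_le_mul₀ (by nlinarith)]
    have e : (1 + 6 * x) * (1 - x) ^ 2 = 1 + x * ((1 - 2 * x) * (4 - 3 * x)) := by ring
    rw [e]
    have : 0 ≤ x * ((1 - 2 * x) * (4 - 3 * x)) :=
      mul_nonneg hx0.le (mul_nonneg (by linarith) (by linarith))
    linarith
  have hg : E * x / (1 - E * x) ≤ E * x + 6 * x ^ 2 := by
    rw [div_le_iff₀ (by linarith)]
    have h5 : (E * x) ^ 2 ≤ (21 / 16) ^ 2 * x ^ 2 := by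
      rw [mul_pow]; gcongr
    have h6 : 6 * x ^ 2 * (11 / 32) ≤ 6 * x ^ 2 * (1 - E * x) := by gcongr; linarith
    nlinarith [sq_nonneg x]
  have hg0 : 0 ≤ E * x / (1 - E * x) := div_nonneg hr0.le (by linarith)
  calc ((1 - x)⁻¹) ^ 2 * (E * x / (1 - E * x)) ≤ (1 + 6 * x) * (E * x + 6 * x ^ 2) := by gcongr
    _ = E * x + (6 * E + 6) * x ^ 2 + 36 * x * x ^ 2 := by ring
    _ ≤ (1 + 2 * t) * x + (6 * (21 / 16) + 6) * x ^ 2 + 36 * (1 / 2) * x ^ 2 := by gcongr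
    _ ≤ x + 2 * t * x + 32 * x ^ 2 := by nlinarith [sq_nonneg x]

theorem anatomy (y : ℝ) (hy : 2 ≤ y) (j : ℕ) (A : Finset ℕ)
    (hA : ∀ a ∈ A, a ≠ 0 ∧ (∀ p ∈ a.primeFactors, (p : ℝ) ≤ y) ∧ a.primeFactors.card = j) :
    ∑ a ∈ A, HH a * ((a : ℝ) ^ (1 / (4 * Real.log y)) / a) ≤
      Real.exp 69 * Real.log y / √(Real.log (Real.log y) + 69) := by
  have hy0 : 0 < y := by linarith
  have hly : 0 < Real.log y := Real.log_pos (by linarith)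
  have hly2 : (1 / 2 : ℝ) ≤ Real.log y := by
    have := Real.log_le_log (by norm_num) hy
    linarith [Real.log_two_gt_d9]
  set η := 1 / (4 * Real.log y) with hη
  have hη0 : 0 < η := by positivity
  set P := Nat.primesLE ⌊y⌋₊ with hPdef
  have hPm : ∀ p, p ∈ P ↔ (p : ℝ) ≤ y ∧ p.Prime := by
    intro p; rw [hPdef, Nat.mem_primesLE, Nat.le_floor_iff hy0.le]
  set T := Real.log (Real.log y) + 69 with hT
  have hT1 : 1 ≤ T := by
    have h1 : Real.log (1 / 2) ≤ Real.log (Real.log y) := Real.log_le_log (by norm_num) hly2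
    rw [one_div, Real.log_inv] at h1
    linarith [Real.log_two_lt_d9]
  have htp : ∀ p ∈ P, 0 ≤ η * Real.log p ∧ η * Real.log p ≤ 1 / 4 := by
    intro p hp
    rw [hPm] at hp
    have h1 : (1 : ℝ) ≤ p := by exact_mod_cast hp.2.one_lt.le
    refine ⟨mul_nonneg hη0.le (Real.log_nonneg h1), ?_⟩
    have : Real.log p ≤ Real.log y := Real.log_le_log (by linarith) hp.1
    calc η * Real.log p ≤ η * Real.log y := by gcongr
      _ = 1 / 4 := by rw [hη]; field_simp
  -- apply the induction with r p := if p ≤ y then p^η/p else 0 (irrelevant)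
  classical
  let r : ℕ → ℝ := fun p => (p : ℝ) ^ η / p
  have hrp : ∀ p ∈ P, r p = Real.exp (η * Real.log p) / p := by
    intro p hp
    have : (0 : ℝ) < p := by exact_mod_cast ((hPm p).1 hp).2.pos
    change (p : ℝ) ^ η / p = _
    rw [Real.rpow_def_of_pos this, mul_comm]
  have hη1 : η < 1 := by
    rw [hη, div_lt_one (by positivity)]
    have := Real.log_le_log (by norm_num) hy
    linarith [Real.log_two_gt_d9]
  have key := anatomy_induct (fun a => HH a * ((a : ℝ) ^ η / a)) (fun p => ((1 - (p : ℝ)⁻¹)⁻¹) ^ 2) r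
    (by simp [HH]) (fun n => mul_nonneg (le_trans zero_le_one (one_le_HH n)) (by positivity))
    (fun p _ => by positivity) (fun p _ => by positivity)
    (by
      intro p hp
      have h1 : (1 : ℝ) < p := by exact_mod_cast hp.one_lt
      change (p : ℝ) ^ η / p < 1
      rw [div_lt_one (by linarith)]
      conv_rhs => rw [← Real.rpow_one (p : ℝ)]
      exact Real.rpow_lt_rpow_of_exponent_lt h1 hη1)
    (by
      intro p i m hp hi hm
      have hc : (p ^ i).Coprime m := Nat.Coprime.pow_left _ ((hp.coprime_iff_not_dvd).2 hm)
      rw [HH_mul hc]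
      have e1 : HH (p ^ i) = ((1 - (p : ℝ)⁻¹)⁻¹) ^ 2 := by
        unfold HH
        rw [Nat.primeFactors_prime_pow (by omega) hp, prod_singleton]
      rw [e1]
      change _ = ((1 - (p : ℝ)⁻¹)⁻¹) ^ 2 * ((p : ℝ) ^ η / p) ^ i * (HH m * ((m : ℝ) ^ η / m))
      push_cast
      rw [Real.mul_rpow (by positivity) (by positivity), div_pow, ← Real.rpow_natCast ((p : ℝ) ^ η) i,
        ← Real.rpow_mul (by positivity), mul_comm η, Real.rpow_mul (by positivity), Real.rpow_natCast]
      rw [mul_div_mul_comm]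
      ring)
    P (fun p hp => ((hPm p).1 hp).2) j A
    (by
      intro a ha
      obtain ⟨h0, h1, h2⟩ := hA a ha
      refine ⟨h0, fun p hp => ?_, h2⟩
      rw [hPm]
      exact ⟨h1 p hp, Nat.prime_of_mem_primeFactors hp⟩)
  refine key.trans ?_
  have hSle : ∑ p ∈ P, ((1 - (p : ℝ)⁻¹)⁻¹) ^ 2 * (r p / (1 - r p)) ≤ T := by
    have h1 : ∑ p ∈ P, ((1 - (p : ℝ)⁻¹)⁻¹) ^ 2 * (r p / (1 - r p)) ≤
        ∑ p ∈ P, ((p : ℝ)⁻¹ + 2 * η * (Real.log p / p) + 32 * ((p : ℝ) ^ 2)⁻¹) := by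
      apply sum_le_sum
      intro p hp
      rw [hrp p hp]
      have := (G_bound p ((hPm p).1 hp).2 (η * Real.log p) (htp p hp).1 (htp p hp).2).2
      refine this.trans (le_of_eq ?_)
      ring
    refine h1.trans ?_
    rw [sum_add_distrib, sum_add_distrib, ← mul_sum, ← mul_sum]
    have hfl : 2 ≤ ⌊y⌋₊ := Nat.le_floor (by simpa using hy)
    have hfl2 : (2 : ℝ) ≤ (⌊y⌋₊ : ℝ) := by exact_mod_cast hfl
    have hlf : Real.log (⌊y⌋₊ : ℝ) ≤ Real.log y := Real.log_le_log (by linarith) (Nat.floor_le hy0.le)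
    have hlf0 : 0 < Real.log (⌊y⌋₊ : ℝ) := Real.log_pos (by linarith)
    have m1 := mertens_two_upper ⌊y⌋₊ hfl
    have m2 := mertens_one ⌊y⌋₊
    have m3 := sum_inv_sq P
    have m4 : Real.log (Real.log (⌊y⌋₊ : ℝ)) ≤ Real.log (Real.log y) := Real.log_le_log hlf0 hlf
    have m5 : 2 * η * ∑ p ∈ P, Real.log p / p ≤ 1 := by
      calc 2 * η * ∑ p ∈ P, Real.log p / p ≤ 2 * η * (2 * Real.log y) := by
            apply mul_le_mul_of_nonneg_left _ (by positivity)
            linarith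
        _ = 1 := by rw [hη]; field_simp; norm_num
    linarith
  have hS0 : 0 ≤ ∑ p ∈ P, ((1 - (p : ℝ)⁻¹)⁻¹) ^ 2 * (r p / (1 - r p)) := by
    apply sum_nonneg
    intro p hp
    rw [hrp p hp]
    have h3 := (G_bound p ((hPm p).1 hp).2 (η * Real.log p) (htp p hp).1 (htp p hp).2).1
    apply mul_nonneg (by positivity)
    apply div_nonneg (by positivity)
    linarith
  calc _ ≤ T ^ j / j.factorial := by gcongr
    _ ≤ Real.exp T / √T := poisson_le T hT1 j
    _ = _ := by
      rw [hT, Real.exp_add, Real.exp_log hly, mul_comm]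

end P5

section P6
open Finset

/-- `(a, b)` is the smooth part of `(n, n+1)` at level `u` -/
def Good (M n a b u : ℕ) : Prop :=
  a ∣ n ∧ b ∣ n + 1 ∧ 0 < a ∧ 0 < b ∧ (a * b) ^ 2 ≤ M ∧
  (∀ q ∈ a.primeFactors, q ^ u ≤ M) ∧ (∀ q ∈ b.primeFactors, q ^ u ≤ M) ∧
  (∀ q : ℕ, q.Prime → q ^ (2 * u) < M → ¬ q ∣ a * b → ¬ q ∣ n * (n + 1)) ∧
  M ^ u < (a * b) ^ (2 * u) * M ^ 2

theorem omega_le (M n d a p : ℕ) (hp : 1 < p) (hn : n ≠ 0) (hnM : n ≤ M) (ha : a = d.gcd n)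
    (hq : ∀ q : ℕ, q.Prime → q ∣ n → ¬ q ∣ d → p ≤ q) :
    n.primeFactors.card ≤ a.primeFactors.card + Nat.log p M := by
  classical
  set Q := n.primeFactors.filter (fun q => ¬ q ∣ a) with hQ
  have h1 : n.primeFactors ⊆ a.primeFactors ∪ Q := by
    intro q hqn
    rw [mem_union, hQ, mem_filter]
    by_cases h : q ∣ a
    · left
      refine Nat.mem_primeFactors.2 ⟨Nat.prime_of_mem_primeFactors hqn, h, ?_⟩
      rw [ha]
      exact Nat.gcd_ne_zero_right hn
    · exact Or.inr ⟨hqn, h⟩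
  have h2 : Q.card ≤ Nat.log p M := by
    apply Nat.le_log_of_pow_le hp
    have h3 : p ^ Q.card ≤ ∏ q ∈ Q, q := by
      apply pow_card_le_prod
      intro q hq'
      rw [hQ, mem_filter] at hq'
      refine hq q (Nat.prime_of_mem_primeFactors hq'.1) (Nat.dvd_of_mem_primeFactors hq'.1) ?_
      intro hd
      apply hq'.2
      rw [ha]
      exact Nat.dvd_gcd hd (Nat.dvd_of_mem_primeFactors hq'.1)
    have h4 : ∏ q ∈ Q, q ∣ n :=
      (prod_dvd_prod_of_subset _ _ _ (filter_subset _ _)).trans (Nat.prod_primeFactors_dvd n)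
    exact h3.trans ((Nat.le_of_dvd (Nat.pos_of_ne_zero hn) h4).trans hnM)
  calc _ ≤ (a.primeFactors ∪ Q).card := card_le_card h1
    _ ≤ _ := (card_union_le _ _).trans (by omega)

theorem exists_good (M n : ℕ) (hn : 0 < n) (hnM : n + 1 ≤ M) (hbig : M < (n * (n + 1)) ^ 2) :
    ∃ a b u, Good M n a b u ∧ 1 ≤ u ∧ 2 ^ u ≤ M ∧
      a.primeFactors.card ≤ n.primeFactors.card ∧ n.primeFactors.card ≤ a.primeFactors.card + u ∧
      b.primeFactors.card ≤ (n + 1).primeFactors.card ∧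
      (n + 1).primeFactors.card ≤ b.primeFactors.card + u := by
  classical
  set N := n * (n + 1) with hN
  have hN0 : N ≠ 0 := by positivity
  set S := N.divisors.filter (fun d => d ^ 2 ≤ M ∧ ∀ q q' : ℕ, q.Prime → q'.Prime → q ∣ d → q' ∣ N / d → q ≤ q') with hS
  have hS1 : 1 ∈ S := by
    rw [hS, mem_filter]
    refine ⟨by simp [hN0], by omega, ?_⟩
    intro q q' hq _ h1
    exact absurd (Nat.dvd_one.1 h1) hq.one_lt.ne'
  have hdS : S.max' ⟨1, hS1⟩ ∈ S := max'_mem _ _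
  have hdmax : ∀ e ∈ S, e ≤ S.max' ⟨1, hS1⟩ := fun e he => le_max' _ _ he
  set d := S.max' ⟨1, hS1⟩
  rw [hS, mem_filter, Nat.mem_divisors] at hdS
  obtain ⟨⟨⟨m, hm⟩, -⟩, hd2, hord⟩ := hdS
  have hd0 : 0 < d := by
    rcases Nat.eq_zero_or_pos d with h | h
    · rw [h] at hm; simp at hm; exact absurd hm hN0
    · exact h
  have hNd : N / d = m := by rw [hm, Nat.mul_div_cancel_left _ hd0]
  rw [hNd] at hord
  have hm1 : m ≠ 1 := by
    intro h
    rw [h, mul_one] at hm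
    rw [← hm] at hd2
    omega
  have hm0 : m ≠ 0 := by
    intro h; rw [h, mul_zero] at hm; exact hN0 hm
  set p := m.minFac with hp
  have hpp : p.Prime := Nat.minFac_prime hm1
  obtain ⟨m', hm'⟩ := Nat.minFac_dvd m
  rw [← hp] at hm'
  have hdp : M < (d * p) ^ 2 := by
    by_contra hcon
    push Not at hcon
    have : d * p ∈ S := by
      rw [hS, mem_filter, Nat.mem_divisors]
      have hNe : N = d * p * m' := by rw [hm, hm']; ring
      refine ⟨⟨⟨m', hNe⟩, hN0⟩, hcon, ?_⟩
      have : N / (d * p) = m' := by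
        rw [hNe]
        exact Nat.mul_div_cancel_left _ (Nat.mul_pos hd0 hpp.pos)
      rw [this]
      intro q q' hq hq' h1 h2
      have hq'm : q' ∣ m := by rw [hm']; exact h2.mul_left p
      have hpq' : p ≤ q' := Nat.minFac_le_of_dvd hq'.two_le hq'm
      rcases (hq.dvd_mul).1 h1 with h | h
      · exact hord q q' hq hq' h hq'm
      · exact (Nat.le_of_dvd hpp.pos h).trans hpq'
    have := hdmax _ this
    have h2 := hpp.two_le
    nlinarith
  have hpN : p ∣ N := by rw [hm]; exact (Nat.minFac_dvd m).mul_left d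
  have hpM : p ≤ M := by
    rcases (hpp.dvd_mul).1 hpN with h | h
    · have := Nat.le_of_dvd hn h; omega
    · have := Nat.le_of_dvd (by omega) h; omega
  have hM0 : M ≠ 0 := by omega
  set u := Nat.log p M with hu
  have hu1 : 1 ≤ u := Nat.log_pos hpp.one_lt hpM
  have hpu : p ^ u ≤ M := Nat.pow_log_le_self p hM0
  have hpu1 : M < p ^ (u + 1) := Nat.lt_pow_succ_log_self hpp.one_lt M
  have hdle : ∀ q : ℕ, q.Prime → q ∣ d → q ≤ p := fun q hq h =>
    hord q p hq hpp h (Nat.minFac_dvd m)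
  have hge : ∀ q : ℕ, q.Prime → q ∣ N → ¬ q ∣ d → p ≤ q := by
    intro q hq h1 h2
    rw [hm] at h1
    exact Nat.minFac_le_of_dvd hq.two_le (((hq.dvd_mul).1 h1).resolve_left h2)
  have hab : d.gcd n * d.gcd (n + 1) = d := by
    have hc : n.Coprime (n + 1) := by simp
    rw [← hc.gcd_mul d]
    exact Nat.gcd_eq_left ⟨m, hm⟩
  have hnsub : ∀ x y : ℕ, y ≠ 0 → x ∣ y → x.primeFactors.card ≤ y.primeFactors.card :=
    fun x y hy h => card_le_card (Nat.primeFactors_mono h hy)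
  refine ⟨d.gcd n, d.gcd (n + 1), u, ⟨Nat.gcd_dvd_right _ _, Nat.gcd_dvd_right _ _,
    Nat.gcd_pos_of_pos_left _ hd0, Nat.gcd_pos_of_pos_left _ hd0, ?_, ?_, ?_, ?_, ?_⟩, hu1, ?_,
    hnsub _ _ (by omega) (Nat.gcd_dvd_right _ _), ?_, hnsub _ _ (by omega) (Nat.gcd_dvd_right _ _), ?_⟩
  · rw [hab]; exact hd2
  · intro q hq
    refine le_trans (Nat.pow_le_pow_left (hdle q (Nat.prime_of_mem_primeFactors hq) ?_) u) hpu
    exact (Nat.dvd_of_mem_primeFactors hq).trans (Nat.gcd_dvd_left _ _)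
  · intro q hq
    refine le_trans (Nat.pow_le_pow_left (hdle q (Nat.prime_of_mem_primeFactors hq) ?_) u) hpu
    exact (Nat.dvd_of_mem_primeFactors hq).trans (Nat.gcd_dvd_left _ _)
  · rw [hab]
    intro q hq hqM hqd hqN
    have h1 := hge q hq hqN hqd
    have h2 : p ^ (u + 1) ≤ q ^ (2 * u) :=
      (Nat.pow_le_pow_left h1 _).trans (Nat.pow_le_pow_right hq.pos (by omega))
    omega
  · rw [hab]
    calc M ^ u < ((d * p) ^ 2) ^ u := Nat.pow_lt_pow_left hdp (by omega)
      _ = d ^ (2 * u) * (p ^ u) ^ 2 := by ring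
      _ ≤ d ^ (2 * u) * M ^ 2 := by gcongr
  · exact (Nat.pow_le_pow_left hpp.two_le u).trans hpu
  · exact omega_le M n d _ p hpp.one_lt (by omega) (by omega) rfl
      (fun q hq h1 h2 => hge q hq (h1.mul_right _) h2)
  · exact omega_le M (n + 1) d _ p hpp.one_lt (by omega) (by omega) rfl
      (fun q hq h1 h2 => hge q hq (h1.mul_left _) h2)

theorem good_count (M u : ℕ) (hM : 16 ≤ M) (hu : 1 ≤ u) (huM : 2 ^ u ≤ M) (j j' : ℕ) (D : Finset ℕ)
    (hD : ∀ n ∈ D, n ∈ Ioc 0 M ∧ ∃ a b, Good M n a b u ∧ a.primeFactors.card = j ∧ b.primeFactors.card = j') :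
    (D.card : ℝ) ≤ (8 * 216 ^ 2 + 64) * Real.exp 138 * Real.exp (1 / 4) *
      (M / Real.log (Real.log M)) * ((u + 1) * Real.exp (-(u : ℝ) / 8)) := by
  classical
  set K : ℝ := 8 * 216 ^ 2 + 64 with hK
  have hMr : (16 : ℝ) ≤ M := by exact_mod_cast hM
  have hM0 : (0 : ℝ) < M := by linarith
  have hu0 : (0 : ℝ) < u := by exact_mod_cast hu
  have hu1 : (1 : ℝ) ≤ u := by exact_mod_cast hu
  have hlM : 0 < Real.log M := Real.log_pos (by linarith)
  set y : ℝ := (M : ℝ) ^ (1 / (u : ℝ)) with hy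
  have hyu : y ^ u = M := by
    rw [hy, ← Real.rpow_natCast, ← Real.rpow_mul hM0.le, one_div, inv_mul_cancel₀ hu0.ne', Real.rpow_one]
  have hy0 : 0 < y := Real.rpow_pos_of_pos hM0 _
  have hle : ∀ x : ℝ, 0 ≤ x → x ^ u ≤ M → x ≤ y := by
    intro x hx h
    rw [← hyu] at h
    exact le_of_pow_le_pow_left₀ (by omega) hy0.le h
  have hy2 : 2 ≤ y := hle 2 (by norm_num) (by exact_mod_cast huM)
  have hly : Real.log y = Real.log M / u := by rw [hy, Real.log_rpow hM0]; ring
  have hly0 : 0 < Real.log y := Real.log_pos (by linarith)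
  set T := Real.log (Real.log y) + 69 with hT
  have hL0 : 0 < Real.log (Real.log M) := by
    apply Real.log_pos
    have h1 : Real.log 16 ≤ Real.log M := Real.log_le_log (by norm_num) hMr
    have h2 : Real.log 16 = 4 * Real.log 2 := by
      rw [show (16 : ℝ) = 2 ^ 4 by norm_num, Real.log_pow]; norm_num
    linarith [Real.log_two_gt_d9]
  have hT1 : 1 ≤ T := by
    have hly2 : (1 / 2 : ℝ) ≤ Real.log y := by
      have := Real.log_le_log (by norm_num) hy2
      linarith [Real.log_two_gt_d9]
    have h1 : Real.log (1 / 2) ≤ Real.log (Real.log y) := Real.log_le_log (by norm_num) hly2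
    rw [one_div, Real.log_inv] at h1
    linarith [Real.log_two_lt_d9]
  have hTL : 1 / T ≤ (u + 1) / Real.log (Real.log M) := by
    rw [div_le_div_iff₀ (by linarith) hL0]
    have h1 : Real.log (Real.log y) = Real.log (Real.log M) - Real.log u := by
      rw [hly, Real.log_div hlM.ne' hu0.ne']
    have h2 : Real.log u ≤ u := (Real.log_le_sub_one_of_pos hu0).trans (by linarith)
    nlinarith
  set η := 1 / (4 * Real.log y) with hη
  have hη0 : 0 < η := by positivity
  set w : ℕ → ℝ := fun a => HH a * ((a : ℝ) ^ η / a) with hw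
  have hw0 : ∀ a, 0 ≤ w a := fun a => mul_nonneg (le_trans zero_le_one (one_le_HH a)) (by positivity)
  set B : ℕ → Finset ℕ := fun i => (Icc 1 M).filter (fun a => a.primeFactors.card = i ∧ ∀ q ∈ a.primeFactors, q ^ u ≤ M) with hB
  have hBsum : ∀ i, ∑ a ∈ B i, w a ≤ Real.exp 69 * Real.log y / √T := by
    intro i
    apply anatomy y hy2 i
    intro a ha
    rw [hB, mem_filter, mem_Icc] at ha
    refine ⟨by omega, ?_, ha.2.1⟩
    intro p hp
    exact hle p (by positivity) (by exact_mod_cast ha.2.2 p hp)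
  set c : ℝ := K * M / (Real.log y) ^ 2 * (Real.exp (1 / 4) * Real.exp (-(u : ℝ) / 8)) with hc
  have hc0 : 0 ≤ c := by positivity
  have hpair : ∀ ab ∈ B j ×ˢ B j', ((D.filter (fun n => Good M n ab.1 ab.2 u)).card : ℝ) ≤ c * (w ab.1 * w ab.2) := by
    rintro ⟨a, b⟩ -
    simp only
    rcases (D.filter (fun n => Good M n a b u)).eq_empty_or_nonempty with he | ⟨n₀, hn₀⟩
    · rw [he, card_empty, Nat.cast_zero]
      exact mul_nonneg hc0 (mul_nonneg (hw0 a) (hw0 b))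
    · rw [mem_filter] at hn₀
      obtain ⟨g1, g2, g3, g4, g5, -, -, -, g9⟩ := hn₀.2
      have hcop : a.Coprime b := by
        have : n₀.Coprime (n₀ + 1) := by simp
        exact (this.coprime_dvd_left g1).coprime_dvd_right g2
      have ha0 : (0 : ℝ) < a := by exact_mod_cast g3
      have hb0 : (0 : ℝ) < b := by exact_mod_cast g4
      have hab0 : (0 : ℝ) < (a : ℝ) * b := by positivity
      have g5' : ((a : ℝ) * b) ^ 2 ≤ M := by exact_mod_cast g5
      have hX : y ^ (1 / 2 : ℝ) ≤ (M : ℝ) / (a * b) := by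
        have hyM : y ≤ M := by
          rw [← hyu]
          exact le_self_pow₀ (by linarith) (by omega)
        rw [← Real.sqrt_eq_rpow]
        have h1 : √y ≤ √M := Real.sqrt_le_sqrt hyM
        refine h1.trans ?_
        rw [le_div_iff₀ hab0]
        have h2 : (a : ℝ) * b ≤ √M := Real.le_sqrt_of_sq_le g5'
        calc √M * (a * b) ≤ √M * √M := by gcongr
          _ = M := Real.mul_self_sqrt hM0.le
      have hs := sieve_final a b M g3 g4 hcop y (by linarith) hX (D.filter (fun n => Good M n a b u)) (by
        intro n hn
        rw [mem_filter] at hn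
        obtain ⟨f1, f2, -, -, -, -, -, f8, -⟩ := hn.2
        refine ⟨(hD n hn.1).1, ⟨f1, f2⟩, ?_⟩
        intro q hq hqy
        apply f8 q hq
        have : ((q : ℝ) ^ 2) ^ u < y ^ u := pow_lt_pow_left₀ hqy (by positivity) (by omega)
        rw [hyu, ← pow_mul] at this
        exact_mod_cast this)
      refine hs.trans ?_
      have hran : 1 ≤ Real.exp (1 / 4) * Real.exp (-(u : ℝ) / 8) * ((a : ℝ) * b) ^ η := by
        rw [Real.rpow_def_of_pos hab0, ← Real.exp_add, ← Real.exp_add]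
        apply Real.one_le_exp
        have g9' : (M : ℝ) ^ u < ((a : ℝ) * b) ^ (2 * u) * (M : ℝ) ^ 2 := by exact_mod_cast g9
        have hl := Real.log_le_log (by positivity) g9'.le
        rw [Real.log_mul (by positivity) (by positivity), Real.log_pow, Real.log_pow, Real.log_pow] at hl
        push_cast at hl
        have e1 : η = u / (4 * Real.log M) := by
          rw [hη, hly]; field_simp
        have e2 : Real.log (a * b) * η = (2 * u * Real.log (a * b)) / (8 * Real.log M) := by
          rw [e1]; field_simp; ring
        rw [e2]
        have h3 : (u * Real.log M - 2 * Real.log M) / (8 * Real.log M) ≤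
            (2 * u * Real.log (a * b)) / (8 * Real.log M) := by
          apply div_le_div_of_nonneg_right _ (by positivity)
          linarith
        have e3 : (u * Real.log M - 2 * Real.log M) / (8 * Real.log M) = u / 8 - 1 / 4 := by
          field_simp; ring
        linarith
      have hH0 : 0 ≤ HH a * HH b := mul_nonneg (le_trans zero_le_one (one_le_HH a)) (le_trans zero_le_one (one_le_HH b))
      rw [HH_mul hcop]
      have e5 : c * (w a * w b) = (K * (HH a * HH b) * (M / (a * b)) / (Real.log y) ^ 2) *
          (Real.exp (1 / 4) * Real.exp (-(u : ℝ) / 8) * ((a : ℝ) * b) ^ η) := by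
        rw [hc, hw, Real.mul_rpow ha0.le hb0.le]
        field_simp
      rw [e5]
      apply le_mul_of_one_le_right _ hran
      positivity
  have hsub : D ⊆ (B j ×ˢ B j').biUnion (fun ab => D.filter (fun n => Good M n ab.1 ab.2 u)) := by
    intro n hn
    obtain ⟨h1, a, b, hg, ha, hb⟩ := hD n hn
    rw [mem_biUnion]
    have hg' := hg
    obtain ⟨g1, g2, g3, g4, g5, g6, g7, g8, g9⟩ := hg'
    have h2 : a * b ≤ M := le_trans (Nat.le_self_pow (by norm_num) _) g5
    have h3 : a ≤ M := le_trans (Nat.le_mul_of_pos_right a g4) h2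
    have h4 : b ≤ M := le_trans (Nat.le_mul_of_pos_left b g3) h2
    refine ⟨(a, b), ?_, mem_filter.2 ⟨hn, hg⟩⟩
    rw [mem_product, hB, mem_filter, mem_filter, mem_Icc, mem_Icc]
    exact ⟨⟨⟨g3, h3⟩, ha, g6⟩, ⟨⟨g4, h4⟩, hb, g7⟩⟩
  have hsT : 0 < √T := Real.sqrt_pos.2 (by linarith)
  calc (D.card : ℝ) ≤ ((∑ ab ∈ B j ×ˢ B j', (D.filter (fun n => Good M n ab.1 ab.2 u)).card : ℕ) : ℝ) := by
        exact_mod_cast (card_le_card hsub).trans card_biUnion_le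
    _ ≤ ∑ ab ∈ B j ×ˢ B j', c * (w ab.1 * w ab.2) := by
        push_cast
        exact sum_le_sum hpair
    _ = c * ((∑ a ∈ B j, w a) * ∑ b ∈ B j', w b) := by
        rw [← mul_sum, sum_mul_sum, sum_product]
    _ ≤ c * ((Real.exp 69 * Real.log y / √T) * (Real.exp 69 * Real.log y / √T)) := by
        apply mul_le_mul_of_nonneg_left _ hc0
        exact mul_le_mul (hBsum j) (hBsum j') (sum_nonneg (fun a _ => hw0 a)) (by positivity)
    _ = K * M * (Real.exp 69 * Real.exp 69) * (Real.exp (1 / 4) * Real.exp (-(u : ℝ) / 8)) * (1 / T) := by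
        have : √T * √T = T := Real.mul_self_sqrt (by linarith)
        have e7 : 1 / T = (1 / √T) * (1 / √T) := by
          rw [div_mul_div_comm, this, one_mul]
        rw [hc, e7]
        field_simp
    _ = K * M * Real.exp 138 * (Real.exp (1 / 4) * Real.exp (-(u : ℝ) / 8)) * (1 / T) := by
        rw [← Real.exp_add]; norm_num
    _ ≤ K * M * Real.exp 138 * (Real.exp (1 / 4) * Real.exp (-(u : ℝ) / 8)) * ((u + 1) / Real.log (Real.log M)) := by
        gcongr
    _ = _ := by ring

theorem upper_M : ∃ C : ℝ, 0 < C ∧ ∀ M : ℕ, 16 ≤ M → ∀ k k' : ℕ, ∀ A : Finset ℕ,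
    (∀ n ∈ A, 0 < n ∧ n + 1 ≤ M ∧ n.primeFactors.card = k ∧ (n + 1).primeFactors.card = k') →
    (A.card : ℝ) ≤ C * (M / Real.log (Real.log M)) := by
  classical
  set K : ℝ := (8 * 216 ^ 2 + 64) * Real.exp 138 * Real.exp (1 / 4) with hK
  have hK0 : 0 < K := by positivity
  have hsm : Summable (fun u : ℕ => ((u : ℝ) + 1) ^ 3 * Real.exp (-(u : ℝ) / 8)) := by
    have h1 := Real.summable_pow_mul_exp_neg_nat_mul 3 (r := 1 / 8) (by norm_num)
    have h2 := ((summable_nat_add_iff 1).2 h1).mul_left (Real.exp (1 / 8))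
    refine h2.congr ?_
    intro u
    push_cast
    rw [mul_left_comm, ← Real.exp_add]
    congr 2
    ring
  set Z := ∑' u : ℕ, ((u : ℝ) + 1) ^ 3 * Real.exp (-(u : ℝ) / 8) with hZ
  have hZ0 : 0 ≤ Z := tsum_nonneg (fun u => by positivity)
  refine ⟨2 + K * Z, by positivity, ?_⟩
  intro M hM k k' A hA
  have hMr : (16 : ℝ) ≤ M := by exact_mod_cast hM
  have hM0 : (0 : ℝ) < M := by linarith
  have hlM : 0 < Real.log M := Real.log_pos (by linarith)
  have hL0 : 0 < Real.log (Real.log M) := by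
    apply Real.log_pos
    have h1 : Real.log 16 ≤ Real.log M := Real.log_le_log (by norm_num) hMr
    have h2 : Real.log 16 = 4 * Real.log 2 := by
      rw [show (16 : ℝ) = 2 ^ 4 by norm_num, Real.log_pow]; norm_num
    linarith [Real.log_two_gt_d9]
  set X := (M : ℝ) / Real.log (Real.log M) with hX
  set U := Nat.log 2 M
  set D : ℕ → ℕ → ℕ → Finset ℕ := fun u j j' =>
    A.filter (fun n => ∃ a b, Good M n a b u ∧ a.primeFactors.card = j ∧ b.primeFactors.card = j') with hD
  have hDb : ∀ u, 1 ≤ u → 2 ^ u ≤ M → ∀ j j', ((D u j j').card : ℝ) ≤ K * X * ((u + 1) * Real.exp (-(u : ℝ) / 8)) := by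
    intro u h1 h2 j j'
    refine good_count M u hM h1 h2 j j' (D u j j') ?_
    intro n hn
    rw [hD, mem_filter] at hn
    obtain ⟨g1, g2, -⟩ := hA n hn.1
    exact ⟨mem_Ioc.2 ⟨g1, by omega⟩, hn.2⟩
  have hsub : A ⊆ Ioc 0 (Nat.sqrt M) ∪ (Icc 1 U).biUnion (fun u => ((range (u + 1)) ×ˢ (range (u + 1))).biUnion
      (fun ii => D u (k - ii.1) (k' - ii.2))) := by
    intro n hn
    obtain ⟨g1, g2, g3, g4⟩ := hA n hn
    rw [mem_union]
    by_cases hb : M < (n * (n + 1)) ^ 2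
    · right
      obtain ⟨a, b, u, hg, hu1, hu2, h3, h4, h5, h6⟩ := exists_good M n g1 g2 hb
      rw [mem_biUnion]
      refine ⟨u, mem_Icc.2 ⟨hu1, Nat.le_log_of_pow_le (by norm_num) hu2⟩, ?_⟩
      rw [mem_biUnion]
      refine ⟨(k - a.primeFactors.card, k' - b.primeFactors.card), ?_, ?_⟩
      · rw [mem_product, mem_range, mem_range]
        constructor <;> simp only <;> omega
      · rw [hD, mem_filter]
        exact ⟨hn, a, b, hg, by simp only; omega, by simp only; omega⟩
    · left
      push Not at hb
      rw [mem_Ioc]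
      refine ⟨g1, Nat.le_sqrt'.2 (le_trans ?_ hb)⟩
      exact Nat.pow_le_pow_left (Nat.le_mul_of_pos_right n (by omega)) 2
  have hcard : (A.card : ℝ) ≤ Nat.sqrt M + ∑ u ∈ Icc 1 U, ∑ ii ∈ (range (u + 1)) ×ˢ (range (u + 1)),
      ((D u (k - ii.1) (k' - ii.2)).card : ℝ) := by
    have h1 := (card_le_card hsub).trans (card_union_le _ _)
    rw [Nat.card_Ioc, Nat.sub_zero] at h1
    have h2 : ((Icc 1 U).biUnion (fun u => ((range (u + 1)) ×ˢ (range (u + 1))).biUnion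
      (fun ii => D u (k - ii.1) (k' - ii.2)))).card ≤ ∑ u ∈ Icc 1 U, ∑ ii ∈ (range (u + 1)) ×ˢ (range (u + 1)),
      (D u (k - ii.1) (k' - ii.2)).card :=
      card_biUnion_le.trans (sum_le_sum (fun u _ => card_biUnion_le))
    exact_mod_cast h1.trans (Nat.add_le_add_left h2 _)
  have hsum : ∑ u ∈ Icc 1 U, ∑ ii ∈ (range (u + 1)) ×ˢ (range (u + 1)),
      ((D u (k - ii.1) (k' - ii.2)).card : ℝ) ≤ K * X * Z := by
    calc _ ≤ ∑ u ∈ Icc 1 U, K * X * (((u : ℝ) + 1) ^ 3 * Real.exp (-(u : ℝ) / 8)) := by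
          apply sum_le_sum
          intro u hu
          rw [mem_Icc] at hu
          have h2 : 2 ^ u ≤ M := (Nat.pow_le_pow_right (by norm_num) hu.2).trans (Nat.pow_log_le_self 2 (by omega))
          refine (sum_le_sum (fun ii _ => hDb u hu.1 h2 _ _)).trans ?_
          rw [sum_const, card_product, card_range, nsmul_eq_mul]
          push_cast
          apply le_of_eq
          ring
      _ = K * X * ∑ u ∈ Icc 1 U, (((u : ℝ) + 1) ^ 3 * Real.exp (-(u : ℝ) / 8)) := by rw [mul_sum]
      _ ≤ K * X * Z := by
          apply mul_le_mul_of_nonneg_left _ (by positivity)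
          exact hsm.sum_le_tsum _ (fun u _ => by positivity)
  have hsq : (Nat.sqrt M : ℝ) ≤ 2 * X := by
    have h1 : (Nat.sqrt M : ℝ) ≤ √M := Real.nat_sqrt_le_real_sqrt
    have h2 : Real.log (Real.log M) ≤ Real.log M := (Real.log_le_sub_one_of_pos hlM).trans (by linarith)
    have h3 : Real.log M ≤ 2 * √M := by
      have := Real.log_le_rpow_div hM0.le (ε := 1 / 2) (by norm_num)
      rw [← Real.sqrt_eq_rpow] at this
      linarith
    have h4 : √(M : ℝ) * √M = M := Real.mul_self_sqrt hM0.le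
    refine h1.trans ?_
    rw [hX, ← mul_div_assoc, le_div_iff₀ hL0]
    have : 0 ≤ √(M : ℝ) := Real.sqrt_nonneg _
    nlinarith
  calc (A.card : ℝ) ≤ 2 * X + K * X * Z := by linarith
    _ = _ := by ring

end P6

section P7
open Finset

theorem omega_eq_sum (N n : ℕ) (hn : n ∈ Ioc 0 N) :
    (n.primeFactors.card : ℝ) = ∑ p ∈ Nat.primesLE N, if p ∣ n then (1 : ℝ) else 0 := by
  rw [← sum_filter, sum_const, nsmul_eq_mul, mul_one]
  congr 2
  rw [mem_Ioc] at hn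
  ext p
  rw [Nat.mem_primeFactors, mem_filter, Nat.mem_primesLE]
  constructor
  · rintro ⟨h1, h2, h3⟩
    exact ⟨⟨(Nat.le_of_dvd hn.1 h2).trans hn.2, h1⟩, h2⟩
  · rintro ⟨⟨h1, h2⟩, h3⟩
    exact ⟨h2, h3, by omega⟩

theorem count_ind (N d : ℕ) : ∑ n ∈ Ioc 0 N, (if d ∣ n then (1 : ℝ) else 0) = ((N / d : ℕ) : ℝ) := by
  rw [← sum_filter, sum_const, nsmul_eq_mul, mul_one, Nat.Ioc_filter_dvd_card_eq_div]

theorem turan (N : ℕ) : ∑ n ∈ Ioc 0 N, ((n.primeFactors.card : ℝ) - ∑ p ∈ Nat.primesLE N, (p : ℝ)⁻¹) ^ 2 ≤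
    3 * N * ∑ p ∈ Nat.primesLE N, (p : ℝ)⁻¹ := by
  set P := Nat.primesLE N with hP
  set s := ∑ p ∈ P, (p : ℝ)⁻¹ with hs
  have hs0 : 0 ≤ s := sum_nonneg (fun p _ => by positivity)
  have h1 : (N : ℝ) * s - N ≤ ∑ n ∈ Ioc 0 N, (n.primeFactors.card : ℝ) := by
    rw [sum_congr rfl (fun n hn => omega_eq_sum N n hn), sum_comm]
    simp only [count_ind]
    have hc : (P.card : ℝ) ≤ N := by
      have : P ⊆ Ioc 0 N := by
        intro p hp
        rw [hP, Nat.mem_primesLE] at hp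
        exact mem_Ioc.2 ⟨hp.2.pos, hp.1⟩
      have := card_le_card this
      rw [Nat.card_Ioc] at this
      exact_mod_cast this
    calc (N : ℝ) * s - N ≤ N * s - P.card := by linarith
      _ = ∑ p ∈ P, ((N : ℝ) * (p : ℝ)⁻¹ - 1) := by rw [sum_sub_distrib, ← mul_sum]; simp [hs]
      _ ≤ _ := by
        apply sum_le_sum
        intro p hp
        have hp0 : 0 < p := (Nat.mem_primesLE.1 hp).2.pos
        have := Nat.lt_div_mul_add (a := N) hp0
        have h3 : (N : ℝ) < (N / p : ℕ) * p + p := by exact_mod_cast this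
        have hp0' : (0 : ℝ) < p := by exact_mod_cast hp0
        have h4 : (N : ℝ) * (p : ℝ)⁻¹ < (N / p : ℕ) + 1 := by
          rw [← div_eq_mul_inv, div_lt_iff₀ hp0']
          linarith
        linarith
  have h2 : ∑ n ∈ Ioc 0 N, (n.primeFactors.card : ℝ) ^ 2 ≤ N * s ^ 2 + N * s := by
    have e1 : ∑ n ∈ Ioc 0 N, (n.primeFactors.card : ℝ) ^ 2 =
        ∑ p ∈ P, ∑ q ∈ P, ∑ n ∈ Ioc 0 N, ((if p ∣ n then (1 : ℝ) else 0) * (if q ∣ n then (1 : ℝ) else 0)) := by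
      rw [sum_congr rfl (fun n hn => by rw [omega_eq_sum N n hn, sq, sum_mul_sum])]
      rw [sum_comm]
      apply sum_congr rfl
      intro p _
      rw [sum_comm]
    rw [e1]
    have hdiv : ∀ d : ℕ, ((N / d : ℕ) : ℝ) ≤ N * (d : ℝ)⁻¹ := by
      intro d
      rw [← div_eq_mul_inv]
      exact Nat.cast_div_le
    calc _ ≤ ∑ p ∈ P, ∑ q ∈ P, ((N : ℝ) * ((p : ℝ)⁻¹ * (q : ℝ)⁻¹) + if p = q then (N : ℝ) * (p : ℝ)⁻¹ else 0) := by
          apply sum_le_sum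
          intro p hp
          apply sum_le_sum
          intro q hq
          have hpp := (Nat.mem_primesLE.1 hp).2
          have hqq := (Nat.mem_primesLE.1 hq).2
          by_cases hpq : p = q
          · subst hpq
            rw [if_pos rfl]
            have : ∀ n ∈ Ioc 0 N, ((if p ∣ n then (1 : ℝ) else 0) * (if p ∣ n then (1 : ℝ) else 0)) = if p ∣ n then (1 : ℝ) else 0 := by
              intro n _; split_ifs <;> simp
            rw [sum_congr rfl this, count_ind]
            have := hdiv p
            have : 0 ≤ (N : ℝ) * ((p : ℝ)⁻¹ * (p : ℝ)⁻¹) := by positivity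
            linarith
          · rw [if_neg hpq, add_zero]
            have hco : p.Coprime q := (Nat.coprime_primes hpp hqq).2 hpq
            have : ∀ n ∈ Ioc 0 N, ((if p ∣ n then (1 : ℝ) else 0) * (if q ∣ n then (1 : ℝ) else 0)) = if p * q ∣ n then (1 : ℝ) else 0 := by
              intro n _
              have : p * q ∣ n ↔ p ∣ n ∧ q ∣ n :=
                ⟨fun h => ⟨(dvd_mul_right p q).trans h, (dvd_mul_left q p).trans h⟩,
                 fun h => hco.mul_dvd_of_dvd_of_dvd h.1 h.2⟩
              simp only [this]
              by_cases h1 : p ∣ n <;> by_cases h2 : q ∣ n <;> simp [h1, h2]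
            rw [sum_congr rfl this, count_ind]
            have := hdiv (p * q)
            push_cast at this
            rw [mul_inv] at this
            exact this
      _ = N * s ^ 2 + N * s := by
          simp only [sum_add_distrib]
          congr 1
          · simp only [← mul_sum]
            rw [sq, hs, sum_mul]
          · rw [hs, mul_sum]
            apply sum_congr rfl
            intro p hp
            rw [sum_ite_eq, if_pos hp]
  have e3 : ∑ n ∈ Ioc 0 N, ((n.primeFactors.card : ℝ) - s) ^ 2 =
      ∑ n ∈ Ioc 0 N, (n.primeFactors.card : ℝ) ^ 2 - 2 * s * ∑ n ∈ Ioc 0 N, (n.primeFactors.card : ℝ) + N * s ^ 2 := by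
    rw [mul_sum, ← sum_sub_distrib]
    have : (N : ℝ) * s ^ 2 = ∑ n ∈ Ioc 0 N, s ^ 2 := by simp
    rw [this, ← sum_add_distrib]
    apply sum_congr rfl
    intro n _
    ring
  rw [e3]
  nlinarith

theorem lower_x (x : ℝ) (hx : 16 ≤ x) : ∃ k k' : ℕ, (1 / 2308) * x / Real.log (Real.log x) ≤
    (((Finset.Icc 1 ⌊x⌋₊).filter
      (fun n => n.primeFactors.card = k ∧ (n + 1).primeFactors.card = k')).card : ℝ) := by
  classical
  have hx0 : 0 < x := by linarith
  have hlx : 2.7725 < Real.log x := by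
    have h1 : Real.log 16 ≤ Real.log x := Real.log_le_log (by norm_num) hx
    have h2 : Real.log 16 = 4 * Real.log 2 := by
      rw [show (16 : ℝ) = 2 ^ 4 by norm_num, Real.log_pow]; norm_num
    linarith [Real.log_two_gt_d9]
  set L := Real.log (Real.log x) with hL
  have hL1 : 1 ≤ L := by
    rw [hL, Real.le_log_iff_exp_le (by linarith)]
    linarith [Real.exp_one_lt_d9]
  set m := ⌊x⌋₊ with hm
  set N := m + 1 with hN
  have hm16 : 16 ≤ m := Nat.le_floor (by exact_mod_cast hx)
  have hmx : (m : ℝ) ≤ x := Nat.floor_le hx0.le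
  have hxN : x < N := by
    have := Nat.lt_floor_add_one x
    rw [hN]; push_cast; exact this
  have hN16 : (17 : ℝ) ≤ N := by
    have : 17 ≤ N := by omega
    exact_mod_cast this
  have hNx : (N : ℝ) ≤ x ^ 2 := by
    rw [hN]; push_cast; nlinarith
  set s := ∑ p ∈ Nat.primesLE N, (p : ℝ)⁻¹ with hs
  have hsL : s ≤ L + 5 := by
    have h1 := mertens_two_upper N (by omega)
    have h2 : Real.log N ≤ 2 * Real.log x := by
      have := Real.log_le_log (by linarith) hNx
      rw [Real.log_pow] at this
      exact_mod_cast this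
    have h3 : Real.log (Real.log N) ≤ Real.log (2 * Real.log x) :=
      Real.log_le_log (Real.log_pos (by linarith)) h2
    rw [Real.log_mul (by norm_num) (by linarith)] at h3
    linarith [Real.log_two_lt_d9]
  have hs0 : 0 < s := by
    apply sum_pos
    · intro p hp
      have := (Nat.mem_primesLE.1 hp).2.pos
      positivity
    · exact ⟨2, Nat.mem_primesLE.2 ⟨by omega, Nat.prime_two⟩⟩
  have htur := turan N
  rw [← hs] at htur
  set bad := (Ioc 0 N).filter (fun n => 24 * s < ((n.primeFactors.card : ℝ) - s) ^ 2) with hbad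
  have hbadc : (bad.card : ℝ) ≤ N / 8 := by
    have h1 : bad.card * (24 * s) ≤ 3 * N * s := by
      calc (bad.card : ℝ) * (24 * s) = ∑ n ∈ bad, 24 * s := by rw [sum_const, nsmul_eq_mul]
        _ ≤ ∑ n ∈ bad, ((n.primeFactors.card : ℝ) - s) ^ 2 := by
          apply sum_le_sum
          intro n hn
          exact (mem_filter.1 hn).2.le
        _ ≤ ∑ n ∈ Ioc 0 N, ((n.primeFactors.card : ℝ) - s) ^ 2 :=
          sum_le_sum_of_subset_of_nonneg (filter_subset _ _) (fun _ _ _ => sq_nonneg _)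
        _ ≤ _ := htur
    have h2 : (bad.card : ℝ) * 24 ≤ 3 * N := by
      by_contra hcon
      push Not at hcon
      nlinarith
    linarith
  set good := (Icc 1 m).filter (fun n => n ∉ bad ∧ n + 1 ∉ bad) with hgood
  have hgoodc : x / 2 ≤ (good.card : ℝ) := by
    have hsub : Icc 1 m ⊆ good ∪ (bad ∪ bad.image (fun n => n - 1)) := by
      intro n hn
      rw [mem_union, mem_union, hgood, mem_filter, mem_image]
      by_cases h1 : n ∈ bad
      · exact Or.inr (Or.inl h1)
      · by_cases h2 : n + 1 ∈ bad
        · exact Or.inr (Or.inr ⟨n + 1, h2, by simp⟩)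
        · exact Or.inl ⟨hn, h1, h2⟩
    have h1 := card_le_card hsub
    have h2 := card_union_le good (bad ∪ bad.image (fun n => n - 1))
    have h3 := card_union_le bad (bad.image (fun n => n - 1))
    have h4 : (bad.image (fun n => n - 1)).card ≤ bad.card := card_image_le
    rw [Nat.card_Icc] at h1
    have h5 : N ≤ good.card + 2 * bad.card + 1 := by omega
    have h6 : (N : ℝ) ≤ good.card + 2 * bad.card + 1 := by exact_mod_cast h5
    linarith
  set t := √(24 * s) with ht
  have ht0 : 0 ≤ t := Real.sqrt_nonneg _
  have htsq : t ^ 2 = 24 * s := Real.sq_sqrt (by positivity)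
  set I := Icc ⌈s - t⌉₊ ⌊s + t⌋₊ with hI
  have hIc : (I.card : ℝ) ≤ 2 * t + 1 := by
    rw [hI, Nat.card_Icc]
    rcases le_total ⌈s - t⌉₊ (⌊s + t⌋₊ + 1) with h | h
    · rw [Nat.cast_sub h]
      push_cast
      have h1 : (⌊s + t⌋₊ : ℝ) ≤ s + t := Nat.floor_le (by positivity)
      have h2 : s - t ≤ (⌈s - t⌉₊ : ℝ) := Nat.le_ceil _
      linarith
    · rw [Nat.sub_eq_zero_of_le h]
      push_cast
      linarith
  have hmemI : ∀ n ∈ Ioc 0 N, n ∉ bad → n.primeFactors.card ∈ I := by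
    intro n hn hb
    rw [hbad, mem_filter] at hb
    have h1 : ((n.primeFactors.card : ℝ) - s) ^ 2 ≤ 24 * s := by
      by_contra hcon
      push Not at hcon
      exact hb ⟨hn, hcon⟩
    rw [← htsq] at h1
    have h2 := abs_le_of_sq_le_sq' h1 ht0
    rw [hI, mem_Icc, Nat.ceil_le, Nat.le_floor_iff (by positivity)]
    constructor <;> linarith
  have hmaps : ∀ n ∈ good, (n.primeFactors.card, (n + 1).primeFactors.card) ∈ I ×ˢ I := by
    intro n hn
    rw [hgood, mem_filter, mem_Icc] at hn
    rw [mem_product]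
    exact ⟨hmemI n (mem_Ioc.2 ⟨by omega, by omega⟩) hn.2.1,
      hmemI (n + 1) (mem_Ioc.2 ⟨by omega, by omega⟩) hn.2.2⟩
  have hne : (I ×ˢ I).Nonempty := by
    have : 0 < good.card := by
      have : (0 : ℝ) < good.card := by linarith
      exact_mod_cast this
    obtain ⟨n, hn⟩ := card_pos.1 this
    exact ⟨_, hmaps n hn⟩
  obtain ⟨⟨k, k'⟩, -, hk⟩ := exists_le_card_fiber_of_nsmul_le_card_of_maps_to
    (b := (1 / 2308) * x / L) hmaps hne (by
      rw [nsmul_eq_mul, card_product]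
      push_cast
      have h1 : (I.card : ℝ) * I.card ≤ 1154 * L := by
        have h2 : (I.card : ℝ) * I.card ≤ (2 * t + 1) * (2 * t + 1) := by gcongr
        nlinarith [sq_nonneg (2 * t - 1)]
      calc (I.card : ℝ) * I.card * (1 / 2308 * x / L) ≤ 1154 * L * (1 / 2308 * x / L) := by gcongr
        _ = x / 2 := by field_simp; norm_num
        _ ≤ _ := hgoodc)
  refine ⟨k, k', hk.trans ?_⟩
  norm_cast
  apply card_le_card
  intro n hn
  rw [mem_filter, hgood, mem_filter] at hn
  rw [mem_filter]
  exact ⟨hn.1.1, (Prod.mk.inj hn.2).1, (Prod.mk.inj hn.2).2⟩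

theorem upper_x : ∃ C : ℝ, 0 < C ∧ ∀ x : ℝ, 16 ≤ x → ∀ k k' : ℕ,
    (((Finset.Icc 1 ⌊x⌋₊).filter
      (fun n => n.primeFactors.card = k ∧ (n + 1).primeFactors.card = k')).card : ℝ) ≤
      C * x / Real.log (Real.log x) := by
  obtain ⟨C, hC, h⟩ := upper_M
  refine ⟨2 * C, by positivity, ?_⟩
  intro x hx k k'
  have hx0 : 0 < x := by linarith
  have hlx : 1 < Real.log x := by
    have h1 : Real.log 16 ≤ Real.log x := Real.log_le_log (by norm_num) hx
    have h2 : Real.log 16 = 4 * Real.log 2 := by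
      rw [show (16 : ℝ) = 2 ^ 4 by norm_num, Real.log_pow]; norm_num
    linarith [Real.log_two_gt_d9]
  have hL0 : 0 < Real.log (Real.log x) := Real.log_pos hlx
  have hm16 : 16 ≤ ⌊x⌋₊ := Nat.le_floor (by exact_mod_cast hx)
  have hmx : (⌊x⌋₊ : ℝ) ≤ x := Nat.floor_le hx0.le
  have hxM := Nat.lt_floor_add_one x
  have h1 := h (⌊x⌋₊ + 1) (by omega) k k' ((Finset.Icc 1 ⌊x⌋₊).filter
      (fun n => n.primeFactors.card = k ∧ (n + 1).primeFactors.card = k')) (by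
    intro n hn
    rw [mem_filter, mem_Icc] at hn
    exact ⟨by omega, by omega, hn.2.1, hn.2.2⟩)
  refine h1.trans ?_
  push_cast
  have h2 : Real.log x ≤ Real.log ((⌊x⌋₊ : ℝ) + 1) := Real.log_le_log hx0 hxM.le
  have h3 : Real.log (Real.log x) ≤ Real.log (Real.log ((⌊x⌋₊ : ℝ) + 1)) := Real.log_le_log (by linarith) h2
  calc C * (((⌊x⌋₊ : ℝ) + 1) / Real.log (Real.log ((⌊x⌋₊ : ℝ) + 1))) ≤ C * ((2 * x) / Real.log (Real.log x)) := by
        gcongr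
        linarith
    _ = _ := by ring

end P7

/-- There exist constants `c, C > 0` and `x₀ ≥ 3` such that for all reals `x ≥ x₀`,
`c·x/log log x ≤ max_{k,k'} #{n ≤ x : ω(n) = k, ω(n+1) = k'} ≤ C·x/log log x`,
where `ω(n)` is the number of distinct prime factors of `n`. The maximum is expressed by
giving a lower bound for some pair `(k, k')` and an upper bound for every pair. -/
theorem statement11 :
    ∃ c C x₀ : ℝ, 0 < c ∧ 0 < C ∧ 3 ≤ x₀ ∧ ∀ x : ℝ, x₀ ≤ x →
      (∃ k k' : ℕ,
        c * x / Real.log (Real.log x) ≤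
          (((Finset.Icc 1 ⌊x⌋₊).filter
            (fun n => n.primeFactors.card = k ∧ (n + 1).primeFactors.card = k')).card : ℝ)) ∧
      (∀ k k' : ℕ,
        ((((Finset.Icc 1 ⌊x⌋₊).filter
            (fun n => n.primeFactors.card = k ∧ (n + 1).primeFactors.card = k')).card : ℝ)) ≤
          C * x / Real.log (Real.log x)) := by
  obtain ⟨C, hC, hup⟩ := upper_x
  exact ⟨1 / 2308, C, 16, by norm_num, hC, by norm_num, fun x hx => ⟨lower_x x hx, hup x hx⟩⟩
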